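/- arXiv:2110.07887 — 5 statements merged into one kernel-verified Lean document; each statement's English description precedes it below -/
import Mathlib

section
/- For every scalar t ∈ k and every natural number r, the polynomial (xy)^r·((t^p − t)·x + y) does not belong to the ideal of R generated by x^{2+r} and y^{2+r}. -/
open MvPolynomial TensorProduct

noncomputable section

/-- `R = k[x,y]`, the polynomial ring in two variables with its standard grading. -/
abbrev R (k : Type) [Field k] : Type := MvPolynomial (Fin 2) k

/-- The variable `x`. -/
abbrev Xx (k : Type) [Field k] : R k := X 0
/-- The variable `y`. -/
abbrev Xy (k : Type) [Field k] : R k := X 1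

/-- `R^{(1)}`: the ring `R` viewed as an `R`-algebra via the Frobenius `r ↦ r^p`. -/
def R1 (p : ℕ) (k : Type) [Field k] : Type := MvPolynomial (Fin 2) k

instance (p : ℕ) (k : Type) [Field k] : CommRing (R1 p k) :=
  inferInstanceAs (CommRing (R k))

instance (p : ℕ) (k : Type) [Field k] [Fact p.Prime] [CharP k p] :
    Algebra (R k) (R1 p k) :=
  (frobenius (R k) p).toAlgebra

/-- The Frobenius base change `F(M) = R^{(1)} ⊗_R M` of an `R`-module `M`; in it one has
`a ⊗ r·m = (r^p·a) ⊗ m`. -/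
def F (p : ℕ) (k : Type) [Field k] [Fact p.Prime] [CharP k p]
    (M : Type) [AddCommGroup M] [Module (R k) M] : Type :=
  TensorProduct (R k) (R1 p k) M

section Finst
variable (p : ℕ) (k : Type) [Field k] [Fact p.Prime] [CharP k p]
variable (M : Type) [AddCommGroup M] [Module (R k) M]

instance : AddCommGroup (F p k M) :=
  inferInstanceAs (AddCommGroup (TensorProduct (R k) (R1 p k) M))

/-- `F(M)` is an `R`-module via multiplication on the factor `R^{(1)}`:
`r·(a ⊗ m) = (r·a) ⊗ m`. -/
instance : Module (R k) (F p k M) :=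
  inferInstanceAs (Module (R1 p k) (TensorProduct (R k) (R1 p k) M))

end Finst

/-- The element `a ⊗ m` of `F(M)`, for `a ∈ R^{(1)} = R` and `m ∈ M`. -/
def tmul (p : ℕ) (k : Type) [Field k] [Fact p.Prime] [CharP k p]
    {M : Type} [AddCommGroup M] [Module (R k) M] (a : R k) (m : M) : F p k M :=
  show TensorProduct (R k) (R1 p k) M from (show R1 p k from a) ⊗ₜ[R k] m

/-- The base change `F(φ) : F(A) → F(B)` of an `R`-linear map `φ : A → B`. -/
def Fmap (p : ℕ) (k : Type) [Field k] [Fact p.Prime] [CharP k p]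
    {A B : Type} [AddCommGroup A] [Module (R k) A] [AddCommGroup B] [Module (R k) B]
    (φ : A →ₗ[R k] B) : F p k A →ₗ[R k] F p k B :=
  show TensorProduct (R k) (R1 p k) A →ₗ[R1 p k] TensorProduct (R k) (R1 p k) B from
    LinearMap.baseChange (R1 p k) φ

/-- `R_x`, the localization of `R` at the powers of `x`. -/
abbrev Rx (k : Type) [Field k] : Type := Localization.Away (Xx k)

/-- `R_{xy}`, the localization of `R` at the powers of `xy`. -/
abbrev Rxy (k : Type) [Field k] : Type := Localization.Away (Xx k * Xy k)

/-- The `R`-submodule `N` of `R_{xy}` generated by the images of the canonical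
localization maps `R_x → R_{xy}` and `R_y → R_{xy}`: the image of `R_x` consists of the
elements `f/x^n = (f·y^n)/(xy)^n`, and the image of `R_y` of the elements
`f/y^n = (f·x^n)/(xy)^n`. -/
def NN (k : Type) [Field k] : Submodule (R k) (Rxy k) :=
  Submodule.span (R k)
    ({z | ∃ (f : R k) (n : ℕ),
        z = Localization.mk (f * Xy k ^ n) ⟨(Xx k * Xy k) ^ n, pow_mem (Submonoid.mem_powers _) n⟩} ∪
     {z | ∃ (f : R k) (n : ℕ),
        z = Localization.mk (f * Xx k ^ n) ⟨(Xx k * Xy k) ^ n, pow_mem (Submonoid.mem_powers _) n⟩})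

/-- `E = R_{xy}/N`, a model for `H^2_{(x,y)}(R)`, the graded injective hull of `k`. -/
abbrev E (k : Type) [Field k] : Type := Rxy k ⧸ NN k

/-- The fraction `f/(x^a·y^b) = (f·x^b·y^a)/(xy)^{a+b}` as an element of `R_{xy}`. -/
def frac (k : Type) [Field k] (f : R k) (a b : ℕ) : Rxy k :=
  Localization.mk (f * Xx k ^ b * Xy k ^ a)
    ⟨(Xx k * Xy k) ^ (a + b), pow_mem (Submonoid.mem_powers _) (a + b)⟩

/-- The degree-`d` homogeneous elements of `R`, indexed by `d : ℤ` (for `d < 0` only `0`). -/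
def RComp (k : Type) [Field k] (d : ℤ) : Set (R k) :=
  {f | ∃ i : ℕ, (i : ℤ) = d ∧ f.IsHomogeneous i} ∪ {0}

/-- The degree-`d` homogeneous elements of `R_x`: fractions `f/x^n` with `f`
homogeneous of degree `e` and `e - n = d`. -/
def RxComp (k : Type) [Field k] (d : ℤ) : Set (Rx k) :=
  {m | ∃ (f : R k) (e n : ℕ), f.IsHomogeneous e ∧ (e : ℤ) - n = d ∧
    m = Localization.mk f ⟨Xx k ^ n, pow_mem (Submonoid.mem_powers _) n⟩}

/-- The degree-`d` homogeneous elements of `R_{xy}`: fractions `f/(xy)^n` with `f`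
homogeneous of degree `e` and `e - 2n = d`. -/
def RxyComp (k : Type) [Field k] (d : ℤ) : Set (Rxy k) :=
  {m | ∃ (f : R k) (e n : ℕ), f.IsHomogeneous e ∧ (e : ℤ) - 2 * n = d ∧
    m = Localization.mk f ⟨(Xx k * Xy k) ^ n, pow_mem (Submonoid.mem_powers _) n⟩}

/-- The degree-`d` homogeneous elements of `E`: classes of degree-`d` homogeneous
elements of `R_{xy}`. -/
def EComp (k : Type) [Field k] (d : ℤ) : Set (E k) :=
  {e | ∃ m ∈ RxyComp k d, Submodule.Quotient.mk m = e}

/-- The degree-`d` homogeneous elements of `F(M)`: sums of elements `a ⊗ m` with `a`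
homogeneous of degree `i`, `m` homogeneous of degree `j` and `i + p·j = d`. -/
def FComp (p : ℕ) (k : Type) [Field k] [Fact p.Prime] [CharP k p]
    {M : Type} [AddCommGroup M] [Module (R k) M] (HM : ℤ → Set M) (d : ℤ) :
    Set (F p k M) :=
  (AddSubgroup.closure {z | ∃ (a : R k) (m : M) (i : ℕ) (j : ℤ),
    a.IsHomogeneous i ∧ m ∈ HM j ∧ (i : ℤ) + p * j = d ∧ z = tmul p k a m} :
      AddSubgroup (F p k M))

/-- An `R`-linear map between graded modules is homogeneous of degree `d` if it raises
degrees of homogeneous elements by `d`. -/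
def IsDegMap (k : Type) [Field k] {A B : Type} [AddCommGroup A] [Module (R k) A]
    [AddCommGroup B] [Module (R k) B] (HA : ℤ → Set A) (HB : ℤ → Set B)
    (φ : A →ₗ[R k] B) (d : ℤ) : Prop :=
  ∀ (e : ℤ) (a : A), a ∈ HA e → φ a ∈ HB (e + d)

/-- `*Hom_R(A, B)`: the `R`-submodule of `Hom_R(A, B)` consisting of (sums of)
homogeneous maps; its degree-`d` component consists of the degree-`d` maps. -/
def starHom (k : Type) [Field k] {A B : Type} [AddCommGroup A] [Module (R k) A]
    [AddCommGroup B] [Module (R k) B] (HA : ℤ → Set A) (HB : ℤ → Set B) :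
    Submodule (R k) (A →ₗ[R k] B) :=
  Submodule.span (R k) {φ | ∃ d : ℤ, IsDegMap k HA HB φ d}

/-- The degree-`d` component of `*Hom_R(A, B)`. -/
def starHomComp (k : Type) [Field k] {A B : Type} [AddCommGroup A] [Module (R k) A]
    [AddCommGroup B] [Module (R k) B] (HA : ℤ → Set A) (HB : ℤ → Set B) (d : ℤ) :
    Set ↥(starHom k HA HB) :=
  {φ | IsDegMap k HA HB φ.1 d}

/-- The componentwise grading on a direct sum `A ⊕ B`. -/
def ProdComp {A B : Type} (HA : ℤ → Set A) (HB : ℤ → Set B) (d : ℤ) : Set (A × B) :=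
  {z | z.1 ∈ HA d ∧ z.2 ∈ HB d}

/-- An element of `(x^m, y^n)` has no monomial `x^a y^b` with `a < m` and `b < n`. -/
theorem coeff_eq_zero_of_mem_span_pow (k : Type) [Field k] {m n : ℕ} {f : R k}
    (hf : f ∈ Ideal.span {Xx k ^ m, Xy k ^ n}) {d : Fin 2 →₀ ℕ} (h0 : d 0 < m) (h1 : d 1 < n) :
    coeff d f = 0 := by
  obtain ⟨a, b, rfl⟩ := Ideal.mem_span_pair.mp hf
  rw [coeff_add, X_pow_eq_monomial, X_pow_eq_monomial, coeff_mul_monomial', coeff_mul_monomial',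
    if_neg, if_neg, add_zero]
  · simpa using h1
  · simpa using h0

theorem stmt2 (p : ℕ) [Fact p.Prime] (k : Type) [Field k] [CharP k p]
    (t : k) (r : ℕ) :
    (Xx k * Xy k) ^ r * (C (t ^ p - t) * Xx k + Xy k) ∉
      Ideal.span {Xx k ^ (2 + r), Xy k ^ (2 + r)} := by
  intro h
  have hd := coeff_eq_zero_of_mem_span_pow k h
    (d := Finsupp.single 0 r + Finsupp.single 1 (r + 1)) (by simp) (by simp; omega)
  have hf : (Xx k * Xy k) ^ r * (C (t ^ p - t) * Xx k + Xy k) =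
      monomial (Finsupp.single 0 (r + 1) + Finsupp.single 1 r) (t ^ p - t) +
        monomial (Finsupp.single 0 r + Finsupp.single 1 (r + 1)) 1 := by
    simp only [monomial_eq, Finsupp.prod_fintype, pow_zero, implies_true, Fin.prod_univ_two]
    simp
    ring
  have hne : (Finsupp.single 0 (r + 1) + Finsupp.single 1 r : Fin 2 →₀ ℕ) ≠
      Finsupp.single 0 r + Finsupp.single 1 (r + 1) := fun he => by
    simpa using DFunLike.congr_fun he 0
  rw [hf, coeff_add, coeff_monomial, coeff_monomial, if_neg hne, if_pos rfl, zero_add] at hd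
  exact one_ne_zero hd

end
end

section
/- Let α ≥ 1 be an integer and let t ∈ R be a homogeneous polynomial of degree α whose coefficient of the monomial y^α is nonzero. Then for every natural number r, the polynomial (xy)^r·(t^p − t·x^{α(p−1)} + y·x^{αp−1}) does not belong to the ideal of R generated by x^{αp+1+r} and y^{αp+2+r}. -/
open MvPolynomial TensorProduct

noncomputable section

theorem coeff_smul_pow_char {σ A : Type*} [CommSemiring A] (p : ℕ) [Fact p.Prime] [CharP A p]
    (f : MvPolynomial σ A) (m : σ →₀ ℕ) : coeff (p • m) (f ^ p) = coeff m f ^ p := by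
  rw [← MvPolynomial.map_frobenius_expand (p := p) (f := f), coeff_map,
    coeff_expand_smul p (Nat.Prime.ne_zero Fact.out), frobenius_def]

theorem stmt3 (p : ℕ) [Fact p.Prime] (k : Type) [Field k] [CharP k p]
    (α : ℕ) (hα : 1 ≤ α) (t : R k) (ht : t.IsHomogeneous α)
    (hty : coeff (Finsupp.single (1 : Fin 2) α) t ≠ 0) (r : ℕ) :
    (Xx k * Xy k) ^ r *
        (t ^ p - t * Xx k ^ (α * (p - 1)) + Xy k * Xx k ^ (α * p - 1)) ∉
      Ideal.span {Xx k ^ (α * p + 1 + r), Xy k ^ (α * p + 2 + r)} := by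
  have hp : 2 ≤ p := (Fact.out : p.Prime).two_le
  have h1 : 1 ≤ α * (p - 1) := Nat.mul_pos hα (by omega)
  have h2 : 1 ≤ α * p - 1 := by
    have : 1 * 2 ≤ α * p := Nat.mul_le_mul hα hp
    omega
  have hc : coeff (Finsupp.single (1 : Fin 2) (α * p))
      (t ^ p - t * Xx k ^ (α * (p - 1)) + Xy k * Xx k ^ (α * p - 1)) ≠ 0 := by
    have h : Finsupp.single (1 : Fin 2) (α * p) = p • Finsupp.single (1 : Fin 2) α := by
      simp [mul_comm]
    have hz (n : ℕ) (hn : 1 ≤ n) (f : R k) :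
        coeff (Finsupp.single (1 : Fin 2) (α * p)) (f * Xx k ^ n) = 0 := by
      rw [X_pow_eq_monomial, coeff_mul_monomial', if_neg]
      intro hle
      have := hle 0
      simp at this
      omega
    rw [coeff_add, coeff_sub, hz _ h1, hz _ h2, sub_zero, add_zero, h, coeff_smul_pow_char]
    exact pow_ne_zero p hty
  intro hmem
  obtain ⟨a, b, hab⟩ := Ideal.mem_span_pair.1 hmem
  have hmon : (Xx k * Xy k) ^ r =
      monomial (Finsupp.single 0 r + Finsupp.single 1 r : Fin 2 →₀ ℕ) (1 : k) := by
    rw [mul_pow, X_pow_eq_monomial, X_pow_eq_monomial, monomial_mul, one_mul]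
  apply hc
  rw [← one_mul (coeff _ _), ← coeff_monomial_mul _
    (Finsupp.single 0 r + Finsupp.single 1 r : Fin 2 →₀ ℕ), ← hmon, ← hab, coeff_add,
    X_pow_eq_monomial, X_pow_eq_monomial, coeff_mul_monomial', coeff_mul_monomial', if_neg,
    if_neg, add_zero]
  · intro hle
    have := hle 1
    simp at this
    omega
  · intro hle
    have := hle 0
    simp at this

end
end

section
/- For every scalar t ∈ k, the element ((t^p − t)·x + y)/(x^2·y^2) of R_{xy} does not lie in the submodule N; equivalently, its class in E = R_{xy}/N is nonzero. In other words, the equation −1/(x^2·y) + t/(x·y^2) = t^p/(x·y^2) fails in E. -/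
open MvPolynomial TensorProduct

noncomputable section

theorem coeff_mul_X_pow_of_lt {σ S : Type*} [CommSemiring S] (f : MvPolynomial σ S) (i : σ)
    {e : ℕ} {m : σ →₀ ℕ} (h : m i < e) : coeff m (f * X i ^ e) = 0 := by
  classical
  rw [X_pow_eq_monomial, coeff_mul_monomial', if_neg]
  intro hle
  have := hle i
  simp at this
  omega

/-- Clearing denominators in an element of `N` gives an element of the ideal `(x^n, y^n)`. -/
theorem exists_smul_eq_of_mem_NN (k : Type) [Field k] {z : Rxy k} (hz : z ∈ NN k) :
    ∃ (n : ℕ) (a b : R k), algebraMap (R k) (Rxy k) ((Xx k * Xy k) ^ n) * z =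
      algebraMap (R k) (Rxy k) (a * Xx k ^ n + b * Xy k ^ n) := by
  induction hz using Submodule.span_induction with
  | mem z h =>
    rcases h with ⟨f, n, rfl⟩ | ⟨f, n, rfl⟩
    · refine ⟨n, 0, f, ?_⟩
      rw [Localization.mk_eq_mk', zero_mul, zero_add]
      exact IsLocalization.mk'_spec' (M := Submonoid.powers (Xx k * Xy k)) _ _
        ⟨(Xx k * Xy k) ^ n, _⟩
    · refine ⟨n, f, 0, ?_⟩
      rw [Localization.mk_eq_mk', zero_mul, add_zero]
      exact IsLocalization.mk'_spec' (M := Submonoid.powers (Xx k * Xy k)) _ _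
        ⟨(Xx k * Xy k) ^ n, _⟩
  | zero => exact ⟨0, 0, 0, by simp⟩
  | add z w _ _ hz hw =>
    obtain ⟨n, a, b, hz⟩ := hz
    obtain ⟨m, c, d, hw⟩ := hw
    refine ⟨n + m, a * Xy k ^ m + c * Xy k ^ n, b * Xx k ^ m + d * Xx k ^ n, ?_⟩
    simp only [map_add, map_mul, map_pow] at hz hw ⊢
    linear_combination
      (algebraMap (R k) (Rxy k) (Xx k) * algebraMap (R k) (Rxy k) (Xy k)) ^ m * hz +
      (algebraMap (R k) (Rxy k) (Xx k) * algebraMap (R k) (Rxy k) (Xy k)) ^ n * hw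
  | smul r z _ hz =>
    obtain ⟨n, a, b, hz⟩ := hz
    refine ⟨n, r * a, r * b, ?_⟩
    rw [Algebra.smul_def]
    simp only [map_add, map_mul, map_pow] at hz ⊢
    linear_combination algebraMap (R k) (Rxy k) r * hz

theorem algebraMap_Rxy_injective (k : Type) [Field k] :
    Function.Injective (algebraMap (R k) (Rxy k)) :=
  IsLocalization.injective (M := Submonoid.powers (Xx k * Xy k)) _ <|
    powers_le_nonZeroDivisors_of_noZeroDivisors <|
    mul_ne_zero (X_ne_zero _) (X_ne_zero _)

theorem stmt6 (p : ℕ) [Fact p.Prime] (k : Type) [Field k] [CharP k p] (t : k) :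
    (Submodule.Quotient.mk (frac k (C (t ^ p - t) * Xx k + Xy k) 2 2) : E k) ≠ 0 := by
  intro h
  rw [Submodule.Quotient.mk_eq_zero] at h
  obtain ⟨n, a, b, h⟩ := exists_smul_eq_of_mem_NN k h
  generalize t ^ p - t = c at h
  have hf : algebraMap (R k) (Rxy k) ((Xx k * Xy k) ^ (2 + 2)) *
      frac k (C c * Xx k + Xy k) 2 2 =
      algebraMap (R k) (Rxy k) ((C c * Xx k + Xy k) * Xx k ^ 2 * Xy k ^ 2) := by
    rw [frac, Localization.mk_eq_mk']
    exact IsLocalization.mk'_spec' (M := Submonoid.powers (Xx k * Xy k)) _ _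
      ⟨(Xx k * Xy k) ^ (2 + 2), _⟩
  have key : (Xx k * Xy k) ^ n * ((C c * Xx k + Xy k) * Xx k ^ 2 * Xy k ^ 2) =
      (Xx k * Xy k) ^ (2 + 2) * (a * Xx k ^ n + b * Xy k ^ n) := by
    apply algebraMap_Rxy_injective k
    rw [map_mul, ← hf, map_mul _ _ (_ + _), ← h]
    ring
  have key' : C c * Xy k ^ (n + 2) * Xx k ^ (n + 3) + Xx k ^ (n + 2) * Xy k ^ (n + 3) =
      a * Xy k ^ 4 * Xx k ^ (n + 4) + b * Xx k ^ 4 * Xy k ^ (n + 4) := by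
    linear_combination key
  have hc := congrArg
    (coeff (Finsupp.single (0 : Fin 2) (n + 2) + Finsupp.single 1 (n + 3))) key'
  have hxy : coeff (Finsupp.single (0 : Fin 2) (n + 2) + Finsupp.single 1 (n + 3))
      (Xx k ^ (n + 2) * Xy k ^ (n + 3)) = 1 := by
    rw [X_pow_eq_monomial, X_pow_eq_monomial, monomial_mul, coeff_monomial, if_pos rfl, one_mul]
  rw [coeff_add, coeff_add, hxy, coeff_mul_X_pow_of_lt _ _ (by simp),
    coeff_mul_X_pow_of_lt _ _ (by simp), coeff_mul_X_pow_of_lt _ _ (by simp)] at hc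
  simp at hc

end
end

section
/- There exists a degree-preserving R-linear isomorphism from *Hom_R(F(R_x), E) to F(*Hom_R(R_x, E)). -/
open MvPolynomial TensorProduct

noncomputable section

namespace FrobeniusDual

variable {p : ℕ} {k : Type} [Field k]

section Cartier

/-- The exponent vector of the monomial `x^{u 0} y^{u 1}`. -/
def expo (u : Fin 2 → Fin p) : Fin 2 →₀ ℕ :=
  Finsupp.equivFunOnFinite.symm fun i => (u i : ℕ)

/-- The monomials `x^i y^j` with `0 ≤ i, j < p`, a basis of `R^{(1)}` over `R`. -/
def mon (k : Type) [Field k] (u : Fin 2 → Fin p) : R k := monomial (expo u) 1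

lemma mon_isHomogeneous (u : Fin 2 → Fin p) : (mon k u).IsHomogeneous (expo u).degree :=
  isHomogeneous_monomial _ rfl

lemma expo_add_smul (u : Fin 2 → Fin p) {s : Fin 2 →₀ ℕ} (h : ∀ i, s i % p = u i) :
    expo u + p • s.mapRange (· / p) (Nat.zero_div p) = s := by
  ext i
  simp [expo, ← h, Nat.mod_add_div]

lemma degree_of_mod_eq (u : Fin 2 → Fin p) {s : Fin 2 →₀ ℕ} (h : ∀ i, s i % p = u i) :
    p * (s.mapRange (· / p) (Nat.zero_div p)).degree + (expo u).degree = s.degree := by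
  conv_rhs => rw [← expo_add_smul u h]
  rw [map_add, map_nsmul, smul_eq_mul, add_comm]

variable [Fact p.Prime] [CharP k p] [PerfectField k]

/-- The coordinate functions of `R^{(1)}` over `R` in the basis `mon k u`. -/
def coord (u : Fin 2 → Fin p) : R k →+ R k :=
  (Finsupp.liftAddHom fun s =>
    if ∀ i, s i % p = u i then
      (monomial (s.mapRange (· / p) (Nat.zero_div p))).toAddMonoidHom.comp
        ((frobeniusEquiv k p).symm : k →+ k)
    else 0).comp AddMonoidAlgebra.coeffAddEquiv.toAddMonoidHom

lemma coord_monomial (u : Fin 2 → Fin p) (s : Fin 2 →₀ ℕ) (c : k) :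
    coord u (monomial s c) = if ∀ i, s i % p = u i then
      monomial (s.mapRange (· / p) (Nat.zero_div p)) ((frobeniusEquiv k p).symm c) else 0 := by
  have : coord u (monomial s c) = (if ∀ i, s i % p = u i then
      (monomial (s.mapRange (· / p) (Nat.zero_div p))).toAddMonoidHom.comp
        ((frobeniusEquiv k p).symm : k →+ k)
    else 0 : k →+ R k) c := by
    simp [coord, monomial]
  rw [this]
  split_ifs <;> simp

lemma coord_pow_mul (u : Fin 2 → Fin p) (a b : R k) :
    coord u (a ^ p * b) = a * coord u b := by
  have hp : 0 < p := (Fact.out : p.Prime).pos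
  induction b using MvPolynomial.induction_on' with
  | add b₁ b₂ h₁ h₂ => simp only [mul_add, map_add, h₁, h₂]
  | monomial t d =>
    induction a using MvPolynomial.induction_on' with
    | add a₁ a₂ h₁ h₂ => simp only [add_pow_char, add_mul, map_add, h₁, h₂]
    | monomial s c =>
      rw [monomial_pow, monomial_mul, coord_monomial, coord_monomial]
      have : (∀ i, (p • s + t) i % p = u i) ↔ ∀ i, t i % p = u i := by simp
      simp only [this]
      split_ifs
      · rw [monomial_mul, map_mul, frobeniusEquiv_symm_pow]
        congr 2
        ext i
        simp [Nat.mul_add_div hp]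
      · simp

lemma sum_mon_mul_coord_pow (b : R k) :
    ∑ u : Fin 2 → Fin p, mon k u * coord u b ^ p = b := by
  have hp : 0 < p := (Fact.out : p.Prime).pos
  induction b using MvPolynomial.induction_on' with
  | add b₁ b₂ h₁ h₂ =>
    simp only [map_add, add_pow_char, mul_add, Finset.sum_add_distrib, h₁, h₂]
  | monomial t d =>
    rw [Finset.sum_eq_single fun i => (⟨t i % p, Nat.mod_lt _ hp⟩ : Fin p)]
    · rw [coord_monomial, if_pos (by simp), monomial_pow, mon, monomial_mul,
        frobeniusEquiv_symm_pow_p, one_mul, expo_add_smul _ (by simp)]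
    · intro u _ hu
      rw [coord_monomial, if_neg, zero_pow hp.ne', mul_zero]
      exact fun h => hu (funext fun i => Fin.ext (h i).symm)
    · simp

lemma coord_isHomogeneous (u : Fin 2 → Fin p) {f : R k} {e t : ℕ} (hf : f.IsHomogeneous e)
    (h : p * t + (expo u).degree = e) : (coord u f).IsHomogeneous t := by
  have hp : 0 < p := (Fact.out : p.Prime).pos
  rw [f.as_sum, map_sum]
  refine IsHomogeneous.sum _ _ _ fun s hs => ?_
  rw [coord_monomial]
  split_ifs with hu
  · refine isHomogeneous_monomial _ ?_
    refine Nat.eq_of_mul_eq_mul_left hp (Nat.add_right_cancel (m := (expo u).degree) ?_)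
    rw [h, ← hf (mem_support_iff.mp hs), degree_of_mod_eq u hu, Finsupp.degree_eq_weight_one]
    rfl
  · exact isHomogeneous_zero _ _ _

lemma coord_eq_zero (u : Fin 2 → Fin p) {f : R k} {e : ℕ} (hf : f.IsHomogeneous e)
    (h : ∀ t, p * t + (expo u).degree ≠ e) : coord u f = 0 := by
  rw [f.as_sum, map_sum]
  refine Finset.sum_eq_zero fun s hs => ?_
  rw [coord_monomial, if_neg]
  intro hu
  refine h (s.mapRange (· / p) (Nat.zero_div p)).degree ?_
  rw [degree_of_mod_eq u hu, ← hf (mem_support_iff.mp hs), Finsupp.degree_eq_weight_one]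
  rfl

end Cartier

section Localization

variable [Fact p.Prime] [CharP k p] [PerfectField k] {S : Submonoid (R k)}

/-- The map induced by `coord u` on a localization of `R`: `f / s = f s^{p-1} / s^p` is sent to
`coord u (f s^{p-1}) / s`. -/
def locCoord (S : Submonoid (R k)) (u : Fin 2 → Fin p) : Localization S →+ Localization S :=
  AddMonoidHom.mk' (fun z => Localization.liftOn z
    (fun f s => Localization.mk (coord u (f * (s : R k) ^ (p - 1))) s) (by
      intro a c b d h
      obtain ⟨v, hv⟩ := Localization.r_iff_exists.mp h
      refine Localization.mk_eq_mk_iff.mpr (Localization.r_iff_exists.mpr ⟨v, ?_⟩)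
      have h' := mul_pow_sub_one (NeZero.ne p) ((v : R k) * d)
      have h'' := mul_pow_sub_one (NeZero.ne p) ((v : R k) * b)
      have key : ((v : R k) * d) ^ p * (a * (b : R k) ^ (p - 1)) =
          ((v : R k) * b) ^ p * (c * (d : R k) ^ (p - 1)) := by
        linear_combination ((v : R k) * d * b) ^ (p - 1) * hv -
          a * (b : R k) ^ (p - 1) * h' + c * (d : R k) ^ (p - 1) * h''
      simpa only [coord_pow_mul, mul_assoc] using congrArg (coord u) key))
    (by
      intro x y
      induction x using Localization.induction_on with | _ x
      induction y using Localization.induction_on with | _ y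
      obtain ⟨a, b⟩ := x
      obtain ⟨c, d⟩ := y
      have hb := mul_pow_sub_one (NeZero.ne p) (b : R k)
      have hd := mul_pow_sub_one (NeZero.ne p) (d : R k)
      have key : ((b : R k) * c + d * a) * ((b : R k) * d) ^ (p - 1) =
          (b : R k) ^ p * (c * (d : R k) ^ (p - 1)) + (d : R k) ^ p * (a * (b : R k) ^ (p - 1)) := by
        linear_combination c * (d : R k) ^ (p - 1) * hb + a * (b : R k) ^ (p - 1) * hd
      simp only [Localization.add_mk, Localization.liftOn_mk, Submonoid.coe_mul, key, map_add,
        coord_pow_mul])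

lemma locCoord_mk (u : Fin 2 → Fin p) (f : R k) (s : S) :
    locCoord S u (Localization.mk f s) =
      Localization.mk (coord u (f * (s : R k) ^ (p - 1))) s := rfl

omit [PerfectField k] in
lemma add_pow_localization (z w : Localization S) : (z + w) ^ p = z ^ p + w ^ p := by
  obtain ⟨r, hr⟩ := exists_add_pow_prime_eq (Fact.out : p.Prime) z w
  have : (p : Localization S) = 0 := by
    rw [← map_natCast (algebraMap (R k) (Localization S)), CharP.cast_eq_zero, map_zero]
  rw [hr, this]
  ring

lemma locCoord_smul_pow (u : Fin 2 → Fin p) (a : R k) (z : Localization S) :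
    locCoord S u (a • z ^ p) = coord u a • z := by
  induction z using Localization.induction_on with | _ z
  obtain ⟨f, s⟩ := z
  rw [Localization.mk_pow, Localization.smul_mk, Localization.smul_mk, locCoord_mk,
    Localization.mk_eq_mk_iff, Localization.r_iff_exists]
  refine ⟨1, ?_⟩
  have key : a • f ^ p * ((s ^ p : S) : R k) ^ (p - 1) = (f * (s : R k) ^ (p - 1)) ^ p * a := by
    rw [smul_eq_mul, SubmonoidClass.coe_pow]
    ring
  rw [key, coord_pow_mul, SubmonoidClass.coe_pow]
  simp only [smul_eq_mul]
  linear_combination (1 : S) * coord u a * f * mul_pow_sub_one (NeZero.ne p) (s : R k)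

lemma sum_mon_smul_locCoord_pow (z : Localization S) :
    ∑ u : Fin 2 → Fin p, mon k u • locCoord S u z ^ p = z := by
  induction z using Localization.induction_on with | _ z
  obtain ⟨f, s⟩ := z
  simp only [locCoord_mk, Localization.mk_pow, Localization.smul_mk, smul_eq_mul]
  have : ∀ g : (Fin 2 → Fin p) → R k, ∑ u, Localization.mk (g u) (s ^ p) =
      Localization.mk (∑ u, g u) (s ^ p) := fun g => (Localization.mk_sum _ _ _).symm
  rw [this, sum_mon_mul_coord_pow, Localization.mk_eq_mk_iff, Localization.r_iff_exists]
  refine ⟨1, ?_⟩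
  rw [SubmonoidClass.coe_pow]
  linear_combination (1 : S) * f * mul_pow_sub_one (NeZero.ne p) (s : R k)

end Localization

section InjectiveHull

/-- The powers of `xy`. -/
abbrev xyPowers (k : Type) [Field k] : Submonoid (R k) := Submonoid.powers (Xx k * Xy k)

/-- The element `(xy)^n` of the submonoid of powers of `xy`. -/
abbrev xyPow (k : Type) [Field k] (n : ℕ) : xyPowers k :=
  ⟨(Xx k * Xy k) ^ n, pow_mem (Submonoid.mem_powers _) n⟩

lemma xyPow_isHomogeneous (n : ℕ) : ((Xx k * Xy k) ^ n).IsHomogeneous (2 * n) :=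
  ((isHomogeneous_X k 0).mul (isHomogeneous_X k 1)).pow n

lemma xyPow_pow (n m : ℕ) : xyPow k n ^ m = xyPow k (n * m) :=
  Subtype.ext (pow_mul _ _ _).symm

lemma zero_mem_EComp (d : ℤ) : (0 : E k) ∈ EComp k d :=
  ⟨0, ⟨0, (d + 2 * d.natAbs).toNat, d.natAbs, isHomogeneous_zero _ _ _, by lia,
    (Localization.mk_zero _).symm⟩, rfl⟩

lemma add_mem_EComp {d : ℤ} {e₁ e₂ : E k} (h₁ : e₁ ∈ EComp k d) (h₂ : e₂ ∈ EComp k d) :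
    e₁ + e₂ ∈ EComp k d := by
  obtain ⟨_, ⟨f, e, n, hf, hd, rfl⟩, rfl⟩ := h₁
  obtain ⟨_, ⟨g, e', m, hg, hd', rfl⟩, rfl⟩ := h₂
  refine ⟨_, ⟨(Xx k * Xy k) ^ n * g + (Xx k * Xy k) ^ m * f, 2 * n + e', n + m, ?_, by
    push_cast; lia, ?_⟩, Submodule.Quotient.mk_add _⟩
  · refine ((xyPow_isHomogeneous n).mul hg).add ?_
    convert (xyPow_isHomogeneous m).mul hf using 1
    lia
  · rw [Localization.add_mk]
    congr 1
    exact Subtype.ext (pow_add _ _ _).symm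

lemma smul_mem_EComp {i : ℕ} {d : ℤ} {f : R k} {e : E k} (hf : f.IsHomogeneous i)
    (he : e ∈ EComp k d) : f • e ∈ EComp k (i + d) := by
  obtain ⟨_, ⟨g, j, n, hg, rfl, rfl⟩, rfl⟩ := he
  exact ⟨_, ⟨f * g, i + j, n, hf.mul hg, by push_cast; ring, Localization.smul_mk _ _ _⟩, rfl⟩

lemma neg_mem_EComp {d : ℤ} {e : E k} (he : e ∈ EComp k d) : -e ∈ EComp k d := by
  simpa using smul_mem_EComp (isHomogeneous_one (Fin 2) k).neg he

variable [Fact p.Prime] [CharP k p]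

/-- The Frobenius endomorphism of `R_{xy}`, as a semilinear map. -/
def frobRxy (p : ℕ) (k : Type) [Field k] [Fact p.Prime] [CharP k p] :
    Rxy k →ₛₗ[frobenius (R k) p] Rxy k where
  toFun z := z ^ p
  map_add' := add_pow_localization
  map_smul' a z := by rw [Algebra.smul_def, mul_pow, ← map_pow, ← Algebra.smul_def]; rfl

lemma NN_le_comap_frobRxy : NN k ≤ (NN k).comap (frobRxy p k) := by
  refine Submodule.span_le.mpr ?_
  rintro _ (⟨f, n, rfl⟩ | ⟨f, n, rfl⟩) <;>
  refine Submodule.subset_span ?_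
  · refine Or.inl ⟨f ^ p, n * p, ?_⟩
    change Localization.mk (f * Xy k ^ n) (xyPow k n) ^ p = Localization.mk _ (xyPow k (n * p))
    rw [Localization.mk_pow, xyPow_pow, mul_pow, pow_mul]
  · refine Or.inr ⟨f ^ p, n * p, ?_⟩
    change Localization.mk (f * Xx k ^ n) (xyPow k n) ^ p = Localization.mk _ (xyPow k (n * p))
    rw [Localization.mk_pow, xyPow_pow, mul_pow, pow_mul]

/-- The Frobenius action on `E`. -/
def frobE (p : ℕ) (k : Type) [Field k] [Fact p.Prime] [CharP k p] :
    E k →ₛₗ[frobenius (R k) p] E k :=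
  Submodule.mapQ _ _ (frobRxy p k) NN_le_comap_frobRxy

lemma frobE_mk (z : Rxy k) :
    frobE p k (Submodule.Quotient.mk z) = Submodule.Quotient.mk (z ^ p) := rfl

lemma frobE_mem_EComp {d : ℤ} {e : E k} (he : e ∈ EComp k d) : frobE p k e ∈ EComp k (p * d) := by
  obtain ⟨_, ⟨g, j, n, hg, rfl, rfl⟩, rfl⟩ := he
  refine ⟨_, ⟨g ^ p, j * p, n * p, hg.pow p, by push_cast; ring, ?_⟩, rfl⟩
  change Localization.mk g (xyPow k n) ^ p = Localization.mk _ (xyPow k (n * p))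
  rw [Localization.mk_pow, xyPow_pow]

variable [PerfectField k]

lemma locCoord_mem_NN (u : Fin 2 → Fin p) {z : Rxy k} (hz : z ∈ NN k) :
    locCoord (xyPowers k) u z ∈ NN k := by
  induction hz using Submodule.closure_induction with
  | zero => rw [map_zero]; exact zero_mem _
  | add x y _ _ hx hy => rw [map_add]; exact add_mem hx hy
  | smul_mem r x hx =>
    refine Submodule.subset_span ?_
    rcases hx with ⟨f, n, rfl⟩ | ⟨f, n, rfl⟩
    · refine Or.inl ⟨coord u (r * f * (Xx k ^ n) ^ (p - 1)), n, ?_⟩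
      rw [Localization.smul_mk, locCoord_mk]
      congr 1
      rw [mul_comm (coord u _) (Xy k ^ n), ← coord_pow_mul]
      congr 1
      simp only [smul_eq_mul]
      linear_combination r * f * (Xx k ^ n) ^ (p - 1) * mul_pow_sub_one (NeZero.ne p) (Xy k ^ n)
    · refine Or.inr ⟨coord u (r * f * (Xy k ^ n) ^ (p - 1)), n, ?_⟩
      rw [Localization.smul_mk, locCoord_mk]
      congr 1
      rw [mul_comm (coord u _) (Xx k ^ n), ← coord_pow_mul]
      congr 1
      simp only [smul_eq_mul]
      linear_combination r * f * (Xy k ^ n) ^ (p - 1) * mul_pow_sub_one (NeZero.ne p) (Xx k ^ n)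

/-- The coordinate functions of `E` with respect to the isomorphism `F(E) ≅ E`. -/
def coordE (u : Fin 2 → Fin p) : E k →+ E k :=
  QuotientAddGroup.map (NN k).toAddSubgroup (NN k).toAddSubgroup (locCoord (xyPowers k) u)
    fun _ => locCoord_mem_NN u

lemma coordE_mk (u : Fin 2 → Fin p) (z : Rxy k) :
    coordE u (Submodule.Quotient.mk z : E k) =
      Submodule.Quotient.mk (locCoord (xyPowers k) u z) := rfl

lemma coordE_smul_frobE (u : Fin 2 → Fin p) (a : R k) (e : E k) :
    coordE u (a • frobE p k e) = coord u a • e := by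
  obtain ⟨z, rfl⟩ := Submodule.Quotient.mk_surjective _ e
  rw [frobE_mk, ← Submodule.Quotient.mk_smul, coordE_mk, locCoord_smul_pow,
    Submodule.Quotient.mk_smul]

lemma sum_mon_smul_frobE (e : E k) :
    ∑ u : Fin 2 → Fin p, mon k u • frobE p k (coordE u e) = e := by
  obtain ⟨z, rfl⟩ := Submodule.Quotient.mk_surjective _ e
  conv_rhs => rw [← sum_mon_smul_locCoord_pow (p := p) z]
  exact (map_sum (NN k).mkQ _ _).symm

lemma coordE_pow_smul (u : Fin 2 → Fin p) (a : R k) (e : E k) :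
    coordE u (a ^ p • e) = a • coordE u e := by
  conv_lhs => rw [← sum_mon_smul_frobE (p := p) e]
  conv_rhs => rw [← sum_mon_smul_frobE (p := p) e]
  simp only [Finset.smul_sum, map_sum, smul_smul, coordE_smul_frobE, coord_pow_mul]

lemma coordE_mem_EComp (u : Fin 2 → Fin p) {d t : ℤ} {e : E k} (he : e ∈ EComp k d)
    (h : p * t + (expo u).degree = d) : coordE u e ∈ EComp k t := by
  have hp : (0 : ℤ) < p := mod_cast (Fact.out : p.Prime).pos
  have hp' : ((p - 1 : ℕ) : ℤ) = p - 1 := Nat.cast_pred (Fact.out : p.Prime).pos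
  obtain ⟨_, ⟨g, j, n, hg, hj, rfl⟩, rfl⟩ := he
  have hg' := hg.mul ((xyPow_isHomogeneous (k := k) n).pow (p - 1))
  by_cases ht : 0 ≤ t + 2 * n
  · obtain ⟨r, hr⟩ := Int.eq_ofNat_of_zero_le ht
    refine ⟨_, ⟨_, r, n, coord_isHomogeneous u hg' ?_, by lia, rfl⟩, rfl⟩
    zify
    rw [hp', ← hr]
    linear_combination h - hj
  · rw [coordE_mk, locCoord_mk, coord_eq_zero u hg', Localization.mk_zero]
    · exact zero_mem_EComp t
    · intro r hr
      zify at hr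
      rw [hp'] at hr
      refine ht (le_of_le_of_eq (Int.natCast_nonneg r) (mul_left_cancel₀ hp.ne' ?_))
      linear_combination hr + hj - h

lemma coordE_eq_zero (u : Fin 2 → Fin p) {d : ℤ} {e : E k} (he : e ∈ EComp k d)
    (h : ∀ t : ℤ, p * t + (expo u).degree ≠ d) : coordE u e = 0 := by
  have hp' : ((p - 1 : ℕ) : ℤ) = p - 1 := Nat.cast_pred (Fact.out : p.Prime).pos
  obtain ⟨_, ⟨g, j, n, hg, hj, rfl⟩, rfl⟩ := he
  have hg' := hg.mul ((xyPow_isHomogeneous (k := k) n).pow (p - 1))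
  rw [coordE_mk, locCoord_mk, coord_eq_zero u hg', Localization.mk_zero, Submodule.Quotient.mk_zero]
  intro r hr
  zify at hr
  rw [hp'] at hr
  refine h (r - 2 * n) ?_
  linear_combination hr + hj

end InjectiveHull

section BaseChange

variable [Fact p.Prime] [CharP k p]
variable {M P : Type} [AddCommGroup M] [Module (R k) M] [AddCommGroup P] [Module (R k) P]

lemma smul_tmul (a b : R k) (m : M) : a • tmul p k b m = tmul p k (a * b) m := rfl

lemma tmul_add (a : R k) (m n : M) : tmul p k a (m + n) = tmul p k a m + tmul p k a n :=
  TensorProduct.tmul_add _ _ _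

lemma tmul_zero (a : R k) : tmul p k a (0 : M) = 0 :=
  TensorProduct.tmul_zero _ _

lemma add_tmul (a b : R k) (m : M) : tmul p k (a + b) m = tmul p k a m + tmul p k b m :=
  TensorProduct.add_tmul _ _ _

lemma tmul_smul (a r : R k) (m : M) : tmul p k a (r • m) = tmul p k (r ^ p * a) m :=
  (TensorProduct.smul_tmul (R := R k) r (show R1 p k from a) m).symm

lemma sum_tmul {ι : Type*} (s : Finset ι) (a : ι → R k) (m : M) :
    tmul p k (∑ i ∈ s, a i) m = ∑ i ∈ s, tmul p k (a i) m :=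
  TensorProduct.sum_tmul _ _ _

@[elab_as_elim]
lemma F_induction {motive : F p k M → Prop} (z : F p k M)
    (tmul : ∀ a m, motive (tmul p k a m)) (add : ∀ x y, motive x → motive y → motive (x + y)) :
    motive z := by
  have zero : motive 0 := tmul_zero (p := p) (M := M) (0 : R k) ▸ tmul 0 0
  exact TensorProduct.induction_on (motive := motive) z zero tmul (fun x y => add x y)

/-- The additive map underlying `lift σ`. -/
def liftAux (σ : M →ₛₗ[frobenius (R k) p] P) : F p k M →+ P :=
  TensorProduct.liftAddHom (R := R k) (M := R1 p k) (N := M)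
    (AddMonoidHom.mk' (fun a : R k => (DistribSMul.toAddMonoidHom P a).comp σ.toAddMonoidHom)
      fun a b => AddMonoidHom.ext fun m => add_smul (R := R k) a b (σ m))
    fun r a m => by
      change (r ^ p * id (α := R k) a) • σ m = id (α := R k) a • σ (r • m)
      rw [map_smulₛₗ, frobenius_def, smul_smul, mul_comm]

/-- The universal property of the Frobenius base change: a Frobenius-semilinear map from `M`
extends to a linear map from `F(M)`. -/
def lift (σ : M →ₛₗ[frobenius (R k) p] P) : F p k M →ₗ[R k] P where
  __ := liftAux σ
  map_smul' r z := by
    change liftAux σ (r • z) = r • liftAux σ z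
    induction z using F_induction with
    | tmul a m => exact mul_smul r a (σ m)
    | add x y hx hy => rw [smul_add, map_add, map_add, hx, hy, smul_add]

lemma lift_tmul (σ : M →ₛₗ[frobenius (R k) p] P) (a : R k) (m : M) :
    lift σ (tmul p k a m) = a • σ m := rfl

lemma F_hom_ext {f g : F p k M →ₗ[R k] P} (h : ∀ m, f (tmul p k 1 m) = g (tmul p k 1 m)) :
    f = g := by
  ext z
  induction z using F_induction with
  | tmul a m => rw [← mul_one a, ← smul_tmul, map_smul, map_smul, h]
  | add x y hx hy => rw [map_add, map_add, hx, hy]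

end BaseChange

section Duality

variable [Fact p.Prime] [CharP k p]
variable {M : Type} [AddCommGroup M] [Module (R k) M] {HM : ℤ → Set M}

lemma tmul_mem_FComp {a : R k} {m : M} {i : ℕ} {j d : ℤ} (ha : a.IsHomogeneous i)
    (hm : m ∈ HM j) (h : i + p * j = d) : tmul p k a m ∈ FComp p k HM d :=
  AddSubgroup.subset_closure ⟨a, m, i, j, ha, hm, h, rfl⟩

omit [Fact p.Prime] [CharP k p] in
/-- Every element of `*Hom_R(M, E)` is a sum of homogeneous maps. -/
lemma starHom_induction {motive : (M →ₗ[R k] E k) → Prop} {φ : M →ₗ[R k] E k}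
    (hφ : φ ∈ starHom k HM (EComp k)) (zero : motive 0)
    (add : ∀ φ ψ, motive φ → motive ψ → motive (φ + ψ))
    (homogeneous : ∀ φ d, IsDegMap k HM (EComp k) φ d → motive φ) : motive φ := by
  induction hφ using Submodule.closure_induction with
  | zero => exact zero
  | add φ ψ _ _ hφ hψ => exact add φ ψ hφ hψ
  | smul_mem r φ h =>
    obtain ⟨d, hd⟩ := h
    rw [← sum_homogeneousComponent r, Finset.sum_smul]
    refine Finset.sum_induction _ motive add zero fun i _ => ?_
    refine homogeneous _ (i + d) fun e m hm => ?_
    rw [add_left_comm]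
    exact smul_mem_EComp (homogeneousComponent_isHomogeneous i r) (hd e m hm)

lemma isDegMap_lift {φ : M →ₗ[R k] E k} {d : ℤ} (hφ : IsDegMap k HM (EComp k) φ d) :
    IsDegMap k (FComp p k HM) (EComp k) (lift ((frobE p k).comp φ)) (p * d) := by
  intro e z hz
  induction hz using AddSubgroup.closure_induction with
  | zero => rw [map_zero]; exact zero_mem_EComp _
  | add x y _ _ hx hy => rw [map_add]; exact add_mem_EComp hx hy
  | neg x _ hx => rw [map_neg]; exact neg_mem_EComp hx
  | mem z hz =>
    obtain ⟨a, m, i, j, ha, hm, rfl, rfl⟩ := hz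
    rw [add_assoc, ← mul_add]
    exact smul_mem_EComp ha (frobE_mem_EComp (hφ j m hm))

lemma lift_smul (r : R k) (φ : M →ₗ[R k] E k) :
    lift ((frobE p k).comp (r • φ)) = r ^ p • lift ((frobE p k).comp φ) :=
  F_hom_ext fun m => by simp [lift_tmul, frobenius_def]

lemma lift_add (φ ψ : M →ₗ[R k] E k) : lift ((frobE p k).comp (φ + ψ)) =
    lift ((frobE p k).comp φ) + lift ((frobE p k).comp ψ) :=
  F_hom_ext fun m => by simp [lift_tmul]

lemma lift_mem_starHom {φ : M →ₗ[R k] E k} (hφ : φ ∈ starHom k HM (EComp k)) :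
    lift ((frobE p k).comp φ) ∈ starHom k (FComp p k HM) (EComp k) := by
  refine starHom_induction
    (motive := fun φ => lift ((frobE p k).comp φ) ∈ starHom k (FComp p k HM) (EComp k)) hφ ?_
    (fun φ ψ hφ hψ => lift_add φ ψ ▸ add_mem hφ hψ)
    (fun φ d hd => Submodule.subset_span ⟨_, isDegMap_lift hd⟩)
  convert Submodule.zero_mem _
  exact F_hom_ext fun m => by simp [lift_tmul]

/-- The canonical map `F(*Hom_R(M, E)) → *Hom_R(F(M), E)` induced by the Frobenius action
on `E`. -/
def dualMap (p : ℕ) [Fact p.Prime] [CharP k p] (HM : ℤ → Set M) :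
    F p k ↥(starHom k HM (EComp k)) →ₗ[R k] ↥(starHom k (FComp p k HM) (EComp k)) :=
  lift
    { toFun φ := ⟨lift ((frobE p k).comp φ.1), lift_mem_starHom φ.2⟩
      map_add' φ ψ := Subtype.ext (lift_add φ.1 ψ.1)
      map_smul' r φ := Subtype.ext (lift_smul r φ.1) }

lemma dualMap_tmul_apply_tmul (a b : R k) (φ : ↥(starHom k HM (EComp k))) (m : M) :
    (dualMap p HM (tmul p k a φ)).1 (tmul p k b m) = (a * b) • frobE p k (φ.1 m) :=
  (mul_smul a b (frobE p k (φ.1 m))).symm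

variable [PerfectField k]

/-- The coordinates of a map `F(M) → E` under `Hom_R(F(M), E) ≅ F(Hom_R(M, E))`. -/
def coordHom (u : Fin 2 → Fin p) (ψ : F p k M →ₗ[R k] E k) : M →ₗ[R k] E k where
  toFun m := coordE u (ψ (tmul p k 1 m))
  map_add' m n := by rw [tmul_add, map_add, map_add]
  map_smul' r m := by
    rw [tmul_smul, ← smul_tmul, map_smul, coordE_pow_smul, RingHom.id_apply]

lemma coordHom_apply (u : Fin 2 → Fin p) (ψ : F p k M →ₗ[R k] E k) (m : M) :
    coordHom u ψ m = coordE u (ψ (tmul p k 1 m)) := rfl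

lemma isDegMap_coordHom (u : Fin 2 → Fin p) {ψ : F p k M →ₗ[R k] E k} {d t : ℤ}
    (hψ : IsDegMap k (FComp p k HM) (EComp k) ψ d) (h : p * t + (expo u).degree = d) :
    IsDegMap k HM (EComp k) (coordHom u ψ) t := fun e m hm =>
  coordE_mem_EComp u
    (hψ _ _ (tmul_mem_FComp (i := 0) (isHomogeneous_one _ _) hm rfl)) (by rw [← h]; push_cast; ring)

lemma coordHom_eq_zero (hM : AddSubgroup.closure (⋃ d, HM d) = ⊤) (u : Fin 2 → Fin p)
    {ψ : F p k M →ₗ[R k] E k} {d : ℤ} (hψ : IsDegMap k (FComp p k HM) (EComp k) ψ d)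
    (h : ∀ t : ℤ, p * t + (expo u).degree ≠ d) : coordHom u ψ = 0 := by
  ext m
  have hm : m ∈ AddSubgroup.closure (⋃ d, HM d) := hM ▸ AddSubgroup.mem_top m
  induction hm using AddSubgroup.closure_induction with
  | zero => rw [map_zero, map_zero]
  | add x y _ _ hx hy => rw [map_add, map_add, hx, hy]
  | neg x _ hx => rw [map_neg, map_neg, hx]
  | mem x hx =>
    obtain ⟨e, he⟩ := Set.mem_iUnion.mp hx
    refine coordE_eq_zero u (hψ _ _ (tmul_mem_FComp (i := 0) (isHomogeneous_one _ _) he rfl)) ?_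
    intro t ht
    refine h (t - e) ?_
    push_cast at ht
    linear_combination ht

lemma coordHom_add (u : Fin 2 → Fin p) (φ ψ : F p k M →ₗ[R k] E k) :
    coordHom u (φ + ψ) = coordHom u φ + coordHom u ψ :=
  LinearMap.ext fun _ => map_add (coordE u) _ _

lemma coordHom_mem_starHom (hM : AddSubgroup.closure (⋃ d, HM d) = ⊤) (u : Fin 2 → Fin p)
    {ψ : F p k M →ₗ[R k] E k} (hψ : ψ ∈ starHom k (FComp p k HM) (EComp k)) :
    coordHom u ψ ∈ starHom k HM (EComp k) := by
  refine starHom_induction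
    (motive := fun ψ => coordHom u ψ ∈ starHom k HM (EComp k)) hψ ?_
    (fun φ ψ hφ hψ => coordHom_add u φ ψ ▸ add_mem hφ hψ) fun ψ d hd => ?_
  · convert Submodule.zero_mem _
    exact LinearMap.ext fun _ => map_zero (coordE u)
  · by_cases h : ∃ t : ℤ, p * t + (expo u).degree = d
    · obtain ⟨t, ht⟩ := h
      exact Submodule.subset_span ⟨t, isDegMap_coordHom u hd ht⟩
    · rw [coordHom_eq_zero hM u hd (not_exists.mp h)]
      exact zero_mem _

/-- The inverse of `dualMap`. -/
def dualInv (hM : AddSubgroup.closure (⋃ d, HM d) = ⊤)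
    (ψ : ↥(starHom k (FComp p k HM) (EComp k))) : F p k ↥(starHom k HM (EComp k)) :=
  ∑ u, tmul p k (mon k u) ⟨coordHom u ψ.1, coordHom_mem_starHom hM u ψ.2⟩

lemma dualInv_add (hM : AddSubgroup.closure (⋃ d, HM d) = ⊤)
    (φ ψ : ↥(starHom k (FComp p k HM) (EComp k))) :
    dualInv hM (φ + ψ) = dualInv hM φ + dualInv hM ψ := by
  simp only [dualInv, ← Finset.sum_add_distrib, ← tmul_add]
  refine Finset.sum_congr rfl fun u _ => congrArg _ (Subtype.ext (coordHom_add u φ.1 ψ.1))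

lemma dualInv_dualMap (hM : AddSubgroup.closure (⋃ d, HM d) = ⊤)
    (z : F p k ↥(starHom k HM (EComp k))) : dualInv hM (dualMap p HM z) = z := by
  induction z using F_induction with
  | add x y hx hy => rw [map_add, dualInv_add, hx, hy]
  | tmul a φ =>
    have key : ∀ u, (⟨coordHom u (dualMap p HM (tmul p k a φ)).1,
        coordHom_mem_starHom hM u (dualMap p HM (tmul p k a φ)).2⟩ : ↥(starHom k HM (EComp k))) =
        coord u a • φ := fun u => Subtype.ext <| LinearMap.ext fun m => by
      rw [coordHom_apply, dualMap_tmul_apply_tmul, coordE_smul_frobE, mul_one]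
      rfl
    simp only [dualInv, key, tmul_smul]
    rw [← sum_tmul]
    conv_rhs => rw [← sum_mon_mul_coord_pow (p := p) a]
    simp only [mul_comm]

lemma dualMap_dualInv (hM : AddSubgroup.closure (⋃ d, HM d) = ⊤)
    (ψ : ↥(starHom k (FComp p k HM) (EComp k))) : dualMap p HM (dualInv hM ψ) = ψ := by
  refine Subtype.ext (F_hom_ext fun m => ?_)
  rw [dualInv, map_sum, AddSubmonoidClass.coe_finsetSum, LinearMap.sum_apply]
  simp only [dualMap_tmul_apply_tmul, mul_one, coordHom_apply]
  exact sum_mon_smul_frobE _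

lemma dualInv_mem_FComp (hM : AddSubgroup.closure (⋃ d, HM d) = ⊤) {d : ℤ}
    {ψ : ↥(starHom k (FComp p k HM) (EComp k))}
    (hψ : IsDegMap k (FComp p k HM) (EComp k) ψ.1 d) :
    dualInv hM ψ ∈ FComp p k (starHomComp k HM (EComp k)) d := by
  refine sum_mem (B := AddSubgroup (F p k ↥(starHom k HM (EComp k)))) fun u _ => ?_
  by_cases h : ∃ t : ℤ, p * t + (expo u).degree = d
  · obtain ⟨t, ht⟩ := h
    exact tmul_mem_FComp (mon_isHomogeneous u) (isDegMap_coordHom u hψ ht) (by rw [← ht]; ring)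
  · have : (⟨coordHom u ψ.1, coordHom_mem_starHom hM u ψ.2⟩ : ↥(starHom k HM (EComp k))) = 0 :=
      Subtype.ext (coordHom_eq_zero hM u hψ (not_exists.mp h))
    rw [this, tmul_zero]
    exact zero_mem _

end Duality

lemma closure_RxComp : AddSubgroup.closure (⋃ d, RxComp k d) = ⊤ := by
  refine (AddSubgroup.eq_top_iff' _).mpr fun z => ?_
  induction z using Localization.induction_on with | _ z
  obtain ⟨f, s, n, rfl⟩ := z
  rw [← sum_homogeneousComponent f, Localization.mk_sum]
  exact sum_mem fun i _ => AddSubgroup.subset_closure <| Set.mem_iUnion.mpr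
    ⟨i - n, _, i, n, homogeneousComponent_isHomogeneous i f, rfl, rfl⟩

end FrobeniusDual

theorem stmt8 (p : ℕ) [Fact p.Prime] (k : Type) [Field k] [CharP k p] [PerfectField k] :
    ∃ Φ : ↥(starHom k (FComp p k (RxComp k)) (EComp k)) ≃ₗ[R k]
          F p k ↥(starHom k (RxComp k) (EComp k)),
      ∀ (d : ℤ) (φ : ↥(starHom k (FComp p k (RxComp k)) (EComp k))),
        IsDegMap k (FComp p k (RxComp k)) (EComp k) (φ : F p k (Rx k) →ₗ[R k] E k) d →
        Φ φ ∈ FComp p k (starHomComp k (RxComp k) (EComp k)) d := by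
  have hM := FrobeniusDual.closure_RxComp (k := k)
  let Ψ : F p k ↥(starHom k (RxComp k) (EComp k)) ≃ₗ[R k]
      ↥(starHom k (FComp p k (RxComp k)) (EComp k)) :=
    { FrobeniusDual.dualMap p (RxComp k) with
      invFun := FrobeniusDual.dualInv hM
      left_inv := FrobeniusDual.dualInv_dualMap hM
      right_inv := FrobeniusDual.dualMap_dualInv hM }
  exact ⟨Ψ.symm, fun d φ hφ => FrobeniusDual.dualInv_mem_FComp hM hφ⟩

end
end

section
/- There exists a degree-preserving R-linear isomorphism from *Hom_R(R_x, E) to F(*Hom_R(R_x, E)); that is, the graded Matlis dual *Hom_R(R_x, E) of R_x carries a graded F-module structure. -/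
open MvPolynomial TensorProduct

noncomputable section

section Monomials
variable (p : ℕ) (k : Type) [Field k]

/-- The exponent vector with entries in `{0, …, p - 1}` given by `i`. -/
def residueExp {p : ℕ} (i : Fin 2 → Fin p) : Fin 2 →₀ ℕ :=
  Finsupp.equivFunOnFinite.symm fun x => (i x : ℕ)

/-- The monomials `x^i y^j` with `0 ≤ i, j < p`, a basis of `R^{(1)}` over `R`. -/
def residueMonomial (i : Fin 2 → Fin p) : R k := monomial (residueExp i) 1

variable {p k}

lemma weight_one_eq_degree (t : Fin 2 →₀ ℕ) :
    Finsupp.weight (1 : Fin 2 → ℕ) t = t.degree :=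
  (DFunLike.congr_fun Finsupp.degree_eq_weight_one t).symm

lemma isHomogeneous_residueMonomial (i : Fin 2 → Fin p) :
    (residueMonomial p k i).IsHomogeneous (residueExp i).degree :=
  isHomogeneous_monomial _ rfl

lemma smul_add_residueExp_inj {u s : Fin 2 →₀ ℕ} {i j : Fin 2 → Fin p} :
    p • u + residueExp i = p • s + residueExp j ↔ u = s ∧ i = j := by
  refine ⟨fun h => ?_, by rintro ⟨rfl, rfl⟩; rfl⟩
  have hx : ∀ x, p * u x + (i x : ℕ) = p * s x + (j x : ℕ) := fun x => by
    simpa [residueExp] using DFunLike.congr_fun h x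
  have hij : i = j := by
    ext x
    simpa [Nat.mod_eq_of_lt (i x).2, Nat.mod_eq_of_lt (j x).2] using congrArg (· % p) (hx x)
  subst hij
  refine ⟨Finsupp.ext fun x => ?_, rfl⟩
  exact Nat.eq_of_mul_eq_mul_left (i x).pos (Nat.add_right_cancel (hx x))

lemma exists_eq_smul_add_residueExp (hp : 0 < p) (t : Fin 2 →₀ ℕ) :
    ∃ (s : Fin 2 →₀ ℕ) (i : Fin 2 → Fin p), t = p • s + residueExp i := by
  refine ⟨Finsupp.equivFunOnFinite.symm fun x => t x / p, fun x => ⟨t x % p, Nat.mod_lt _ hp⟩, ?_⟩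
  ext x
  simp [residueExp, Nat.div_add_mod]

variable [Fact p.Prime] [CharP k p]

lemma coeff_residueMonomial_mul_pow (i j : Fin 2 → Fin p) (s : Fin 2 →₀ ℕ) (m : R k) :
    coeff (p • s + residueExp j) (residueMonomial p k i * m ^ p) =
      if i = j then coeff s m ^ p else 0 := by
  classical
  induction m using MvPolynomial.induction_on' with
  | monomial u c =>
    have h : p • u + residueExp i = p • s + residueExp j ↔ u = s ∧ i = j := smul_add_residueExp_inj
    simp only [residueMonomial, monomial_pow, monomial_mul, one_mul, coeff_monomial,
      add_comm (residueExp i), h]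
    by_cases hij : i = j <;> by_cases hus : u = s <;>
      simp [hij, hus, (Fact.out : p.Prime).ne_zero]
  | add f g hf hg =>
    rw [add_pow_char, mul_add, coeff_add, hf, hg, coeff_add]
    split_ifs <;> simp [add_pow_char]

lemma coeff_sum_residueMonomial_mul_pow (j : Fin 2 → Fin p) (s : Fin 2 →₀ ℕ)
    (m : (Fin 2 → Fin p) → R k) :
    coeff (p • s + residueExp j) (∑ i, residueMonomial p k i * m i ^ p) = coeff s (m j) ^ p := by
  simp [coeff_sum, coeff_residueMonomial_mul_pow]

lemma eq_zero_of_sum_residueMonomial_mul_pow {m : (Fin 2 → Fin p) → R k}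
    (h : ∑ i, residueMonomial p k i * m i ^ p = 0) : m = 0 := by
  funext j
  ext s
  have := coeff_sum_residueMonomial_mul_pow j s m
  rw [h, coeff_zero] at this
  simpa using (pow_eq_zero_iff (Fact.out : p.Prime).ne_zero).1 this.symm

variable [PerfectField k]

lemma exists_residue_decomposition (a : R k) :
    ∃ m : (Fin 2 → Fin p) → R k, a = ∑ i, residueMonomial p k i * m i ^ p := by
  classical
  induction a using MvPolynomial.induction_on' with
  | monomial t c =>
    obtain ⟨s, i, rfl⟩ := exists_eq_smul_add_residueExp (Fact.out : p.Prime).pos t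
    have : PerfectRing k p := PerfectField.toPerfectRing p
    obtain ⟨c, rfl⟩ := surjective_frobenius k p c
    refine ⟨Pi.single i (monomial s c), ?_⟩
    rw [Finset.sum_eq_single_of_mem i (Finset.mem_univ i) fun j _ hj => by
      simp [Pi.single_eq_of_ne hj, (Fact.out : p.Prime).ne_zero]]
    simp [residueMonomial, monomial_pow, monomial_mul, frobenius_def, add_comm]
  | add f g hf hg =>
    obtain ⟨m, rfl⟩ := hf
    obtain ⟨n, rfl⟩ := hg
    exact ⟨m + n, by simp [add_pow_char, mul_add, Finset.sum_add_distrib]⟩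

lemma exists_homogeneous_residue_decomposition {a : R k} {e : ℕ} (ha : a.IsHomogeneous e) :
    ∃ m : (Fin 2 → Fin p) → R k, a = ∑ i, residueMonomial p k i * m i ^ p ∧
      ∀ i, m i = 0 ∨ ∃ g, (m i).IsHomogeneous g ∧ (residueExp i).degree + p * g = e := by
  obtain ⟨m, rfl⟩ := exists_residue_decomposition (p := p) a
  refine ⟨m, rfl, fun i => ?_⟩
  have key : ∀ s, coeff s (m i) ≠ 0 → (residueExp i).degree + p * s.degree = e := by
    intro s hs
    have := ha (d := p • s + residueExp i) (by
      rw [coeff_sum_residueMonomial_mul_pow]; exact pow_ne_zero _ hs)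
    rw [← this, weight_one_eq_degree, map_add, add_comm, map_nsmul, smul_eq_mul]
  by_cases h0 : m i = 0
  · exact Or.inl h0
  obtain ⟨s, hs⟩ := MvPolynomial.ne_zero_iff.1 h0
  refine Or.inr ⟨s.degree, fun t ht => ?_, key s hs⟩
  have := (key t ht).trans (key s hs).symm
  have h2 := Nat.eq_of_mul_eq_mul_left (Fact.out : p.Prime).pos (Nat.add_left_cancel this)
  rw [weight_one_eq_degree, h2]

end Monomials

section FrobeniusModule
variable {p : ℕ} {k : Type} [Field k] [Fact p.Prime] [CharP k p]
variable {M : Type} [AddCommGroup M] [Module (R k) M]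

lemma F.tmul_add (a : R k) (m n : M) : tmul p k a (m + n) = tmul p k a m + tmul p k a n :=
  TensorProduct.tmul_add _ _ _

lemma F.tmul_zero (a : R k) : tmul p k a (0 : M) = 0 :=
  TensorProduct.tmul_zero _ _

lemma F.tmul_smul (r a : R k) (m : M) : tmul p k a (r • m) = tmul p k (r ^ p * a) m :=
  (TensorProduct.smul_tmul (R := R k) (M := R1 p k) (N := M) r a m).symm

lemma F.sum_tmul {ι : Type*} (s : Finset ι) (a : ι → R k) (m : M) :
    tmul p k (∑ i ∈ s, a i) m = ∑ i ∈ s, tmul p k (a i) m :=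
  TensorProduct.sum_tmul (R := R k) (N := M) s (fun i => (show R1 p k from a i)) m

lemma F.induction {P : F p k M → Prop} (zero : P 0) (tmul : ∀ a m, P (tmul p k a m))
    (add : ∀ s t, P s → P t → P (s + t)) (t : F p k M) : P t :=
  TensorProduct.induction_on (R := R k) (M := R1 p k) (N := M) t zero tmul add

/-- The `R`-linear map `F(M) → M`, `a ⊗ m ↦ a • f m`, induced by a Frobenius-semilinear
endomorphism `f` of `M`. -/
def linearization (f : M →ₛₗ[frobenius (R k) p] M) : F p k M →ₗ[R k] M :=
  let g : F p k M →+ M := TensorProduct.liftAddHom (R := R k) (M := R1 p k) (N := M)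
    { toFun := fun a => ((show R k from a) • f.toAddMonoidHom :  M →+ M)
      map_zero' := zero_smul (R k) f.toAddMonoidHom
      map_add' := fun a b => add_smul (show R k from a) (show R k from b) f.toAddMonoidHom }
    (fun r a m => by
      change (r ^ p * (show R k from a)) • f m = (show R k from a) • f (r • m)
      rw [f.map_smulₛₗ, smul_smul, frobenius_def, mul_comm])
  { g with
    map_smul' := fun r t => by
      change g (r • t) = r • g t
      induction t using F.induction with
      | zero => simp
      | tmul a m => exact mul_smul r a (f m)
      | add s t hs ht => rw [smul_add, map_add, hs, ht, map_add, smul_add] }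

lemma linearization_tmul (f : M →ₛₗ[frobenius (R k) p] M) (a : R k) (m : M) :
    linearization f (tmul p k a m) = a • f m := rfl

lemma Fmap_tmul {N : Type} [AddCommGroup N] [Module (R k) N] (φ : M →ₗ[R k] N) (a : R k) (m : M) :
    Fmap p k φ (tmul p k a m) = tmul p k a (φ m) := rfl

/-- `M` is, through `f`, the direct sum of the `x^i y^j • f(M)` with `0 ≤ i, j < p`, and `f` is
injective; over a perfect field this says that `linearization f` is an isomorphism. -/
def IsUnitFrobenius (f : M →ₛₗ[frobenius (R k) p] M) : Prop :=
  Function.Bijective fun m : (Fin 2 → Fin p) → M => ∑ i, residueMonomial p k i • f (m i)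

lemma isUnitFrobenius_of {f : M →ₛₗ[frobenius (R k) p] M}
    (inj : ∀ m : (Fin 2 → Fin p) → M, ∑ i, residueMonomial p k i • f (m i) = 0 → m = 0)
    (surj : ∀ z, ∃ m : (Fin 2 → Fin p) → M, z = ∑ i, residueMonomial p k i • f (m i)) :
    IsUnitFrobenius f := by
  refine ⟨fun m n h => ?_, fun z => (surj z).imp fun _ h => h.symm⟩
  refine sub_eq_zero.1 (inj _ ?_)
  simpa [smul_sub, sub_eq_zero] using h

variable [PerfectField k]

lemma exists_eq_sum_tmul (t : F p k M) :
    ∃ m : (Fin 2 → Fin p) → M, t = ∑ i, tmul p k (residueMonomial p k i) (m i) := by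
  induction t using F.induction with
  | zero => exact ⟨0, by simp [F.tmul_zero]⟩
  | tmul a m =>
    obtain ⟨c, hc⟩ := exists_residue_decomposition (p := p) a
    refine ⟨fun i => c i • m, ?_⟩
    conv_lhs => rw [hc]
    simp [F.sum_tmul, F.tmul_smul, mul_comm]
  | add s t hs ht =>
    obtain ⟨m, rfl⟩ := hs
    obtain ⟨n, rfl⟩ := ht
    exact ⟨m + n, by simp [F.tmul_add, Finset.sum_add_distrib]⟩

lemma linearization_bijective {f : M →ₛₗ[frobenius (R k) p] M} (hf : IsUnitFrobenius f) :
    Function.Bijective (linearization f) := by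
  refine ⟨(injective_iff_map_eq_zero _).2 fun t ht => ?_, fun z => ?_⟩
  · obtain ⟨m, rfl⟩ := exists_eq_sum_tmul t
    have : m = 0 := hf.1 (by simpa [linearization_tmul] using ht)
    simp [this, F.tmul_zero]
  · obtain ⟨m, rfl⟩ := hf.2 z
    exact ⟨∑ i, tmul p k (residueMonomial p k i) (m i), by simp [linearization_tmul]⟩

/-- The isomorphism `F(M) ≅ M` given by a Frobenius-semilinear `f` of unit type. -/
def linearizationEquiv (f : M →ₛₗ[frobenius (R k) p] M) (hf : IsUnitFrobenius f) :
    F p k M ≃ₗ[R k] M :=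
  LinearEquiv.ofBijective (linearization f) (linearization_bijective hf)

lemma linearizationEquiv_symm_apply (f : M →ₛₗ[frobenius (R k) p] M) (hf : IsUnitFrobenius f)
    (m : M) : (linearizationEquiv f hf).symm (f m) = tmul p k 1 m := by
  rw [LinearEquiv.symm_apply_eq]
  exact (one_smul _ _).symm

/-- Decompositions of generators of a submodule `N` with components in `N` give decompositions
of all elements of `N`. -/
lemma exists_decomposition_of_span {f : M →ₛₗ[frobenius (R k) p] M} {s : Set M}
    (hs : ∀ z ∈ s, ∃ m : (Fin 2 → Fin p) → M, (∀ i, m i ∈ Submodule.span (R k) s) ∧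
      z = ∑ i, residueMonomial p k i • f (m i))
    {z : M} (hz : z ∈ Submodule.span (R k) s) :
    ∃ m : (Fin 2 → Fin p) → M, (∀ i, m i ∈ Submodule.span (R k) s) ∧
      z = ∑ i, residueMonomial p k i • f (m i) := by
  have h : Submodule.span (R k) s ≤
      LinearMap.range (linearization f ∘ₗ Fmap p k (Submodule.span (R k) s).subtype) := by
    refine Submodule.span_le.2 fun z hz => ?_
    obtain ⟨m, hm, rfl⟩ := hs z hz
    exact ⟨∑ i, tmul p k (residueMonomial p k i) ⟨m i, hm i⟩,
      by simp [Fmap_tmul, linearization_tmul]⟩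
  obtain ⟨t, rfl⟩ := h hz
  obtain ⟨m, rfl⟩ := exists_eq_sum_tmul t
  exact ⟨fun i => m i, fun i => (m i).2, by simp [Fmap_tmul, linearization_tmul]⟩

omit [PerfectField k] in
lemma IsUnitFrobenius.mapQ {f : M →ₛₗ[frobenius (R k) p] M} (hf : IsUnitFrobenius f)
    {N : Submodule (R k) M} (hN : N ≤ N.comap f)
    (hdec : ∀ z ∈ N, ∃ m : (Fin 2 → Fin p) → M, (∀ i, m i ∈ N) ∧
      z = ∑ i, residueMonomial p k i • f (m i)) :
    IsUnitFrobenius (N.mapQ N f hN) := by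
  refine isUnitFrobenius_of (fun m hm => ?_) fun z => ?_
  · choose n hn using fun i => N.mkQ_surjective (m i)
    obtain rfl : m = fun i => N.mkQ (n i) := funext fun i => (hn i).symm
    have : N.mkQ (∑ i, residueMonomial p k i • f (n i)) = 0 := by
      rw [← hm, map_sum]; rfl
    obtain ⟨n', hn', h⟩ := hdec _ ((Submodule.Quotient.mk_eq_zero N).1 this)
    have := hf.1 h
    funext i
    exact (Submodule.Quotient.mk_eq_zero N).2 (this ▸ hn' i)
  · obtain ⟨z, rfl⟩ := N.mkQ_surjective z
    obtain ⟨m, rfl⟩ := hf.2 z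
    exact ⟨fun i => N.mkQ (m i), by rw [map_sum]; rfl⟩

/-- The restriction of a Frobenius-semilinear map to a stable submodule. -/
def restrictFrobenius (f : M →ₛₗ[frobenius (R k) p] M) (N : Submodule (R k) M)
    (hN : N ≤ N.comap f) : N →ₛₗ[frobenius (R k) p] N :=
  (f.domRestrict N).codRestrict N fun z => hN z.2

omit [PerfectField k] in
lemma IsUnitFrobenius.restrict {f : M →ₛₗ[frobenius (R k) p] M} (hf : IsUnitFrobenius f)
    {N : Submodule (R k) M} (hN : N ≤ N.comap f)
    (hdec : ∀ z ∈ N, ∃ m : (Fin 2 → Fin p) → M, (∀ i, m i ∈ N) ∧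
      z = ∑ i, residueMonomial p k i • f (m i)) :
    IsUnitFrobenius (restrictFrobenius f N hN) := by
  have hcoe : ∀ m : (Fin 2 → Fin p) → N,
      ((∑ i, residueMonomial p k i • restrictFrobenius f N hN (m i) : N) : M) =
        ∑ i, residueMonomial p k i • f (m i) := fun m => by
    simp only [Submodule.coe_sum, Submodule.coe_smul]
    rfl
  refine isUnitFrobenius_of (fun m hm => ?_) fun z => ?_
  · have h := hcoe m
    rw [hm] at h
    have := hf.1 (a₁ := fun i => (m i : M)) (a₂ := 0) (by simpa using h.symm)
    funext i
    exact Subtype.ext (congrFun this i)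
  · obtain ⟨m, hm, h⟩ := hdec z z.2
    exact ⟨fun i => ⟨m i, hm i⟩, Subtype.ext (by rw [hcoe]; exact h)⟩

end FrobeniusModule

section Hom
variable {p : ℕ} {k : Type} [Field k] [Fact p.Prime] [CharP k p] [PerfectField k]
variable {A B : Type} [AddCommGroup A] [Module (R k) A] [AddCommGroup B] [Module (R k) B]
variable {f : A →ₛₗ[frobenius (R k) p] A} (hf : IsUnitFrobenius f)
  (g : B →ₛₗ[frobenius (R k) p] B)

/-- The Frobenius-semilinear endomorphism of `Hom_R(A, B)` sending `ψ` to the unique `R`-linear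
map `φ` with `φ (f a) = g (ψ a)`. -/
def homFrobenius : (A →ₗ[R k] B) →ₛₗ[frobenius (R k) p] (A →ₗ[R k] B) where
  toFun ψ := linearization g ∘ₗ Fmap p k ψ ∘ₗ (linearizationEquiv f hf).symm.toLinearMap
  map_add' ψ ψ' := by
    ext a
    obtain ⟨m, rfl⟩ := hf.2 a
    simp [linearizationEquiv_symm_apply, Fmap_tmul, linearization_tmul, Finset.sum_add_distrib]
  map_smul' r ψ := by
    ext a
    obtain ⟨m, rfl⟩ := hf.2 a
    simp [linearizationEquiv_symm_apply, Fmap_tmul, linearization_tmul]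

lemma homFrobenius_apply (ψ : A →ₗ[R k] B) (a : A) :
    homFrobenius hf g ψ (f a) = g (ψ a) := by
  change linearization g (Fmap p k ψ ((linearizationEquiv f hf).symm (f a))) = _
  rw [linearizationEquiv_symm_apply, Fmap_tmul, linearization_tmul, one_smul]

omit [PerfectField k] in
include hf in
lemma linearMap_ext_of_frobenius {φ ψ : A →ₗ[R k] B} (h : ∀ a, φ (f a) = ψ (f a)) : φ = ψ := by
  ext a
  obtain ⟨m, rfl⟩ := hf.2 a
  simp [h]

variable {g} (hg : IsUnitFrobenius g)

include hg in
lemma exists_hom_decomposition (φ : A →ₗ[R k] B) :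
    ∃ ψ : (Fin 2 → Fin p) → A →ₗ[R k] B,
      φ = ∑ i, residueMonomial p k i • homFrobenius hf g (ψ i) := by
  choose m hm using fun a => hg.2 (φ (f a))
  refine ⟨fun i =>
    { toFun := fun a => m a i
      map_add' := fun a b => congrFun (hg.1 (a₁ := m (a + b)) (a₂ := m a + m b) ?_) i
      map_smul' := fun r a => congrFun (hg.1 (a₁ := m (r • a)) (a₂ := r • m a) ?_) i },
    linearMap_ext_of_frobenius hf fun a => ?_⟩
  · simp only at hm
    simp [hm, Finset.sum_add_distrib]
  · simp only at hm
    simp only [hm, Pi.smul_apply, map_smulₛₗ]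
    simp [← hm, Finset.smul_sum, smul_comm (frobenius (R k) p r)]
  · simpa [homFrobenius_apply] using (hm a).symm

include hg in
lemma isUnitFrobenius_homFrobenius : IsUnitFrobenius (homFrobenius hf g) := by
  refine isUnitFrobenius_of (fun ψ h => ?_) (exists_hom_decomposition hf hg)
  funext i
  ext a
  have := LinearMap.congr_fun h (f a)
  exact congrFun (hg.1 (a₁ := fun i => ψ i a) (a₂ := 0)
    (by simpa [homFrobenius_apply] using this)) i

end Hom

section Localization
variable {p : ℕ} {k : Type} [Field k]

/-- The fraction `f / g^n` in the localization at the powers of `g`. -/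
abbrev awayMk (g f : R k) (n : ℕ) : Localization.Away g :=
  Localization.mk f ⟨g ^ n, pow_mem (Submonoid.mem_powers _) n⟩

lemma awayMk_mul_pow (g f : R k) (n m : ℕ) : awayMk g (f * g ^ m) (n + m) = awayMk g f n := by
  rw [awayMk, awayMk, Localization.mk_eq_mk_iff, Localization.r_iff_exists]
  exact ⟨1, by simp only [OneMemClass.coe_one, one_mul]; ring⟩

lemma smul_awayMk (g r f : R k) (n : ℕ) : r • awayMk g f n = awayMk g (r * f) n := by
  rw [awayMk, Localization.smul_mk, smul_eq_mul]

lemma awayMk_pow (g f : R k) (n m : ℕ) : awayMk g f n ^ m = awayMk g (f ^ m) (n * m) := by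
  rw [awayMk, Localization.mk_pow]
  congr 1
  exact Subtype.ext (pow_mul g n m).symm

lemma awayMk_sum (g : R k) {ι : Type*} (s : Finset ι) (f : ι → R k) (n : ℕ) :
    awayMk g (∑ i ∈ s, f i) n = ∑ i ∈ s, awayMk g (f i) n :=
  Localization.mk_sum _ _ _

lemma exists_eq_awayMk (g : R k) (z : Localization.Away g) : ∃ f n, z = awayMk g f n := by
  induction z using Localization.induction_on with
  | H y =>
    obtain ⟨f, s, n, rfl⟩ := y
    exact ⟨f, n, rfl⟩

variable [Fact p.Prime] [CharP k p]

/-- The Frobenius `z ↦ z^p` of an `R`-algebra as a Frobenius-semilinear map. -/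
def algebraFrobenius (p : ℕ) (k : Type) [Field k] [Fact p.Prime] [CharP k p] (S : Type) [CommRing S] [Algebra (R k) S]
    [CharP S p] :
    S →ₛₗ[frobenius (R k) p] S where
  toFun := frobenius S p
  map_add' := map_add _
  map_smul' r z := by
    simp [Algebra.smul_def, frobenius_def, mul_pow]

lemma algebraFrobenius_apply (S : Type) [CommRing S] [Algebra (R k) S] [CharP S p] (z : S) :
    algebraFrobenius p k S z = z ^ p := rfl

lemma algebraMap_away_injective {g : R k} (hg : g ≠ 0) :
    Function.Injective (algebraMap (R k) (Localization.Away g)) :=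
  IsLocalization.injective _ (powers_le_nonZeroDivisors_of_noZeroDivisors hg)

omit [Fact p.Prime] in
lemma charP_away {g : R k} (hg : g ≠ 0) : CharP (Localization.Away g) p :=
  charP_of_injective_algebraMap (algebraMap_away_injective hg) p

instance : CharP (Rx k) p := charP_away (X_ne_zero 0)

instance : CharP (Rxy k) p := charP_away (mul_ne_zero (X_ne_zero 0) (X_ne_zero 1))

lemma add_pred_mul (n : ℕ) : n + (p - 1) * n = n * p := by
  obtain ⟨q, hq⟩ := Nat.exists_eq_succ_of_ne_zero (Fact.out : p.Prime).ne_zero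
  subst hq
  simp only [Nat.succ_eq_add_one, Nat.add_sub_cancel]
  ring

lemma awayMk_eq_sum {g f : R k} {n : ℕ} {m : (Fin 2 → Fin p) → R k}
    [CharP (Localization.Away g) p]
    (h : f * g ^ ((p - 1) * n) = ∑ i, residueMonomial p k i * m i ^ p) :
    awayMk g f n =
      ∑ i, residueMonomial p k i • algebraFrobenius p k (Localization.Away g) (awayMk g (m i) n) := by
  simp only [algebraFrobenius_apply, awayMk_pow, smul_awayMk]
  rw [← awayMk_sum, ← h, ← add_pred_mul n, awayMk_mul_pow]

variable [PerfectField k]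

lemma isUnitFrobenius_away {g : R k} (hg : g ≠ 0) [CharP (Localization.Away g) p] :
    IsUnitFrobenius (algebraFrobenius p k (Localization.Away g)) := by
  refine isUnitFrobenius_of (fun z hz => ?_) fun z => ?_
  · obtain ⟨⟨b, n, rfl⟩, hb⟩ :=
      IsLocalization.exist_integer_multiples (Submonoid.powers g) Finset.univ z
    choose m hm using fun i => hb i (Finset.mem_univ i)
    have hm' : ∀ i, algebraMap _ (Localization.Away g) (m i) = algebraMap _ _ (g ^ n) * z i :=
      fun i => (hm i).trans (Algebra.smul_def _ _)
    have h0 : m = 0 := by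
      refine eq_zero_of_sum_residueMonomial_mul_pow (algebraMap_away_injective hg ?_)
      rw [map_zero, ← smul_zero ((g ^ n) ^ p), ← hz, map_sum, Finset.smul_sum]
      refine Finset.sum_congr rfl fun i _ => ?_
      rw [map_mul, map_pow, hm', algebraFrobenius_apply]
      simp only [Algebra.smul_def, map_pow]
      ring
    funext i
    have hu : IsUnit (algebraMap (R k) (Localization.Away g) (g ^ n)) :=
      IsLocalization.map_units _ (⟨g ^ n, n, rfl⟩ : Submonoid.powers g)
    refine hu.mul_left_cancel ?_
    rw [← hm', h0]
    simp
  · obtain ⟨f, n, rfl⟩ := exists_eq_awayMk g z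
    obtain ⟨m, hm⟩ := exists_residue_decomposition (p := p) (f * g ^ ((p - 1) * n))
    exact ⟨_, awayMk_eq_sum hm⟩

omit [PerfectField k] in
lemma NN_le_comap : NN k ≤ (NN k).comap (algebraFrobenius p k (Rxy k)) := by
  refine Submodule.span_le.2 ?_
  rintro _ (⟨f, n, rfl⟩ | ⟨f, n, rfl⟩)
  · refine Submodule.subset_span (Or.inl ⟨f ^ p, n * p, ?_⟩)
    rw [algebraFrobenius_apply, awayMk_pow, mul_pow, pow_mul]
  · refine Submodule.subset_span (Or.inr ⟨f ^ p, n * p, ?_⟩)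
    rw [algebraFrobenius_apply, awayMk_pow, mul_pow, pow_mul]

omit [PerfectField k] in
/-- The fraction `f u^n / (u v)^n` decomposes into fractions of the same form. -/
lemma awayMk_mul_pow_eq_sum {g f u v : R k} (hg : g = u * v) {n : ℕ}
    {m : (Fin 2 → Fin p) → R k} [CharP (Localization.Away g) p]
    (h : f * v ^ ((p - 1) * n) = ∑ i, residueMonomial p k i * m i ^ p) :
    awayMk g (f * u ^ n) n = ∑ i, residueMonomial p k i •
      algebraFrobenius p k (Localization.Away g) (awayMk g (m i * u ^ n) n) := by
  refine awayMk_eq_sum ?_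
  simp only [mul_pow, ← mul_assoc, ← Finset.sum_mul, ← h]
  rw [hg, mul_pow, ← pow_mul, ← add_pred_mul n, pow_add]
  ring

lemma exists_decomposition_NN {z : Rxy k} (hz : z ∈ NN k) :
    ∃ m : (Fin 2 → Fin p) → Rxy k, (∀ i, m i ∈ NN k) ∧
      z = ∑ i, residueMonomial p k i • algebraFrobenius p k (Rxy k) (m i) := by
  refine exists_decomposition_of_span ?_ hz
  rintro _ (⟨f, n, rfl⟩ | ⟨f, n, rfl⟩)
  · obtain ⟨m, hm⟩ := exists_residue_decomposition (p := p) (f * Xx k ^ ((p - 1) * n))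
    exact ⟨_, fun i => Submodule.subset_span (Or.inl ⟨m i, n, rfl⟩),
      awayMk_mul_pow_eq_sum (mul_comm _ _) hm⟩
  · obtain ⟨m, hm⟩ := exists_residue_decomposition (p := p) (f * Xy k ^ ((p - 1) * n))
    exact ⟨_, fun i => Submodule.subset_span (Or.inr ⟨m i, n, rfl⟩),
      awayMk_mul_pow_eq_sum rfl hm⟩

end Localization

section Graded
variable (p : ℕ) (k : Type) [Field k] [Fact p.Prime] [CharP k p]

/-- The Frobenius-semilinear endomorphism of `E` induced by the Frobenius of `R_{xy}`. -/
def frobeniusE : E k →ₛₗ[frobenius (R k) p] E k :=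
  (NN k).mapQ (NN k) (algebraFrobenius p k (Rxy k)) NN_le_comap

variable {p k}

lemma frobeniusE_mk (z : Rxy k) :
    frobeniusE p k (Submodule.Quotient.mk z) = Submodule.Quotient.mk (z ^ p) := rfl

lemma isUnitFrobenius_Rx [PerfectField k] : IsUnitFrobenius (algebraFrobenius p k (Rx k)) :=
  isUnitFrobenius_away (X_ne_zero 0)

lemma isUnitFrobenius_frobeniusE [PerfectField k] : IsUnitFrobenius (frobeniusE p k) :=
  (isUnitFrobenius_away (mul_ne_zero (X_ne_zero 0) (X_ne_zero 1))).mapQ NN_le_comap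
    fun _ => exists_decomposition_NN

omit [Fact p.Prime] [CharP k p] in
lemma zero_mem_EComp (d : ℤ) : (0 : E k) ∈ EComp k d := by
  refine ⟨0, ⟨0, (d + 2 * d.natAbs).toNat, d.natAbs, isHomogeneous_zero _ _ _, by omega, ?_⟩, rfl⟩
  exact (Localization.mk_zero _).symm

omit [Fact p.Prime] [CharP k p] in
lemma smul_mem_EComp {r : R k} {i : ℕ} (hr : r.IsHomogeneous i) {d : ℤ} {z : E k}
    (hz : z ∈ EComp k d) : r • z ∈ EComp k (i + d) := by
  obtain ⟨_, ⟨f, e, n, hf, rfl, rfl⟩, rfl⟩ := hz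
  refine ⟨_, ⟨r * f, i + e, n, hr.mul hf, by push_cast; ring, rfl⟩, ?_⟩
  exact congrArg (NN k).mkQ (smul_awayMk _ r f n).symm

lemma frobeniusE_mem_EComp {d : ℤ} {z : E k} (hz : z ∈ EComp k d) :
    frobeniusE p k z ∈ EComp k (p * d) := by
  obtain ⟨_, ⟨f, e, n, hf, rfl, rfl⟩, rfl⟩ := hz
  refine ⟨_, ⟨f ^ p, e * p, n * p, hf.pow p, by push_cast; ring, rfl⟩, ?_⟩
  rw [frobeniusE_mk, awayMk_pow]

lemma exists_decomposition_EComp [PerfectField k] {d : ℤ} {z : E k} (hz : z ∈ EComp k d) :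
    ∃ m : (Fin 2 → Fin p) → E k, z = ∑ i, residueMonomial p k i • frobeniusE p k (m i) ∧
      ∀ i, m i = 0 ∨ ∃ g : ℤ, m i ∈ EComp k g ∧ (residueExp i).degree + p * g = d := by
  obtain ⟨_, ⟨f, e, n, hf, rfl, rfl⟩, rfl⟩ := hz
  have hxy : (Xx k * Xy k).IsHomogeneous 2 := (isHomogeneous_X k 0).mul (isHomogeneous_X k 1)
  obtain ⟨m, hm, hdeg⟩ := exists_homogeneous_residue_decomposition (p := p)
    (hf.mul (hxy.pow ((p - 1) * n)))
  refine ⟨fun i => Submodule.Quotient.mk (awayMk _ (m i) n), ?_, fun i => ?_⟩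
  · have := congrArg (NN k).mkQ (awayMk_eq_sum hm)
    rw [map_sum] at this
    exact this
  · rcases hdeg i with h | ⟨g, hg, h⟩
    · refine Or.inl ?_
      simp only [h, awayMk, Localization.mk_zero]
      rfl
    · refine Or.inr ⟨g - 2 * n, ⟨_, ⟨m i, g, n, hg, rfl, rfl⟩, rfl⟩, ?_⟩
      have h1 := congrArg (fun t : ℕ => (t : ℤ)) h
      have h2 := congrArg (fun t : ℕ => (t : ℤ)) (add_pred_mul (p := p) n)
      push_cast at h1 h2
      linarith

omit [Fact p.Prime] [CharP k p] in
lemma eq_zero_of_RxComp {B : Type} [AddCommGroup B] [Module (R k) B] {φ : Rx k →ₗ[R k] B}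
    (h : ∀ e, ∀ a ∈ RxComp k e, φ a = 0) : φ = 0 := by
  ext a
  obtain ⟨f, n, rfl⟩ := exists_eq_awayMk _ a
  rw [← mul_one f, ← smul_awayMk, map_smul,
    h (0 - n) _ ⟨1, 0, n, isHomogeneous_one _ _, by simp, rfl⟩]
  simp

omit [Fact p.Prime] [CharP k p] in
lemma pow_mem_RxComp {e : ℤ} {a : Rx k} (ha : a ∈ RxComp k e) : a ^ p ∈ RxComp k (p * e) := by
  obtain ⟨f, e, n, hf, rfl, rfl⟩ := ha
  exact ⟨f ^ p, e * p, n * p, hf.pow p, by push_cast; ring, awayMk_pow _ _ _ _⟩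

variable [PerfectField k]

lemma isDegMap_homFrobenius {ψ : Rx k →ₗ[R k] E k} {d : ℤ}
    (hψ : IsDegMap k (RxComp k) (EComp k) ψ d) :
    IsDegMap k (RxComp k) (EComp k)
      (homFrobenius isUnitFrobenius_Rx (frobeniusE p k) ψ) (p * d) := by
  rintro _ _ ⟨f, e, n, hf, rfl, rfl⟩
  have h : awayMk (Xx k) f n = (f * Xx k ^ ((p - 1) * n)) •
      algebraFrobenius p k (Rx k) (awayMk (Xx k) 1 n) := by
    rw [algebraFrobenius_apply, awayMk_pow, smul_awayMk, one_pow, mul_one, ← add_pred_mul n,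
      awayMk_mul_pow]
  change homFrobenius _ _ _ (awayMk (Xx k) f n) ∈ _
  rw [h, map_smul, homFrobenius_apply]
  have h1 : awayMk (Xx k) 1 n ∈ RxComp k (0 - n) :=
    ⟨1, 0, n, isHomogeneous_one _ _, by simp, rfl⟩
  have := smul_mem_EComp (hf.mul ((isHomogeneous_X k 0).pow ((p - 1) * n)))
    (frobeniusE_mem_EComp (p := p) (hψ _ _ h1))
  convert this using 2
  have h2 := congrArg (fun t : ℕ => (t : ℤ)) (add_pred_mul (p := p) n)
  push_cast at h2 ⊢
  linarith

lemma exists_decomposition_isDegMap {φ : Rx k →ₗ[R k] E k} {d : ℤ}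
    (hφ : IsDegMap k (RxComp k) (EComp k) φ d) :
    ∃ ψ : (Fin 2 → Fin p) → Rx k →ₗ[R k] E k,
      φ = ∑ i, residueMonomial p k i •
        homFrobenius isUnitFrobenius_Rx (frobeniusE p k) (ψ i) ∧
      ∀ i, ψ i = 0 ∨ ∃ g : ℤ, IsDegMap k (RxComp k) (EComp k) (ψ i) g ∧
        (residueExp i).degree + p * g = d := by
  obtain ⟨ψ, hψ⟩ := exists_hom_decomposition (isUnitFrobenius_Rx (p := p) (k := k))
    isUnitFrobenius_frobeniusE φ
  have hp : (p : ℤ) ≠ 0 := by exact_mod_cast (Fact.out : p.Prime).ne_zero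
  have key : ∀ i e, ∀ a ∈ RxComp k e, ψ i a = 0 ∨
      ∃ g : ℤ, ψ i a ∈ EComp k g ∧ (residueExp i).degree + p * g = p * e + d := by
    intro i e a ha
    obtain ⟨m, hm, hdeg⟩ := exists_decomposition_EComp (p := p) (hφ _ _ (pow_mem_RxComp (p := p) ha))
    have : (fun i => ψ i a) = m := by
      refine isUnitFrobenius_frobeniusE.1 ?_
      simp only
      rw [← hm, ← algebraFrobenius_apply (k := k)]
      conv_rhs => rw [hψ]
      simp [homFrobenius_apply]
    rw [← this] at hdeg
    exact hdeg i
  refine ⟨ψ, hψ, fun i => ?_⟩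
  by_cases h : ∃ g : ℤ, (residueExp i).degree + p * g = d
  · obtain ⟨g, hg⟩ := h
    refine Or.inr ⟨g, fun e a ha => ?_, hg⟩
    rcases key i e a ha with h0 | ⟨g', hmem, hg'⟩
    · rw [h0]
      exact zero_mem_EComp _
    · have : g' = e + g := mul_left_cancel₀ hp (by linarith)
      rwa [← this]
  · refine Or.inl (eq_zero_of_RxComp fun e a ha => (key i e a ha).resolve_right ?_)
    rintro ⟨g', -, hg'⟩
    exact h ⟨g' - e, by linarith⟩

lemma starHom_le_comap :
    starHom k (RxComp k) (EComp k) ≤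
      (starHom k (RxComp k) (EComp k)).comap
        (homFrobenius (isUnitFrobenius_Rx (p := p)) (frobeniusE p k)) :=
  Submodule.span_le.2 fun _ ⟨d, hd⟩ => Submodule.subset_span ⟨p * d, isDegMap_homFrobenius hd⟩

lemma exists_decomposition_starHom {φ : Rx k →ₗ[R k] E k}
    (hφ : φ ∈ starHom k (RxComp k) (EComp k)) :
    ∃ ψ : (Fin 2 → Fin p) → Rx k →ₗ[R k] E k,
      (∀ i, ψ i ∈ starHom k (RxComp k) (EComp k)) ∧
      φ = ∑ i, residueMonomial p k i •
        homFrobenius isUnitFrobenius_Rx (frobeniusE p k) (ψ i) := by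
  refine exists_decomposition_of_span ?_ hφ
  rintro φ ⟨d, hd⟩
  obtain ⟨ψ, hψ, hdeg⟩ := exists_decomposition_isDegMap (p := p) hd
  refine ⟨ψ, fun i => ?_, hψ⟩
  rcases hdeg i with h | ⟨g, hg, -⟩
  · rw [h]
    exact zero_mem _
  · exact Submodule.subset_span ⟨g, hg⟩

end Graded

theorem stmt9 (p : ℕ) [Fact p.Prime] (k : Type) [Field k] [CharP k p] [PerfectField k] :
    ∃ Φ : ↥(starHom k (RxComp k) (EComp k)) ≃ₗ[R k]
          F p k ↥(starHom k (RxComp k) (EComp k)),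
      ∀ (d : ℤ) (φ : ↥(starHom k (RxComp k) (EComp k))),
        IsDegMap k (RxComp k) (EComp k) φ.1 d →
        Φ φ ∈ FComp p k (starHomComp k (RxComp k) (EComp k)) d := by
  have hD := (isUnitFrobenius_homFrobenius (isUnitFrobenius_Rx (p := p) (k := k))
    isUnitFrobenius_frobeniusE).restrict starHom_le_comap fun _ => exists_decomposition_starHom
  refine ⟨(linearizationEquiv _ hD).symm, fun d φ hφ => ?_⟩
  obtain ⟨ψ, hψ, hdeg⟩ := exists_decomposition_isDegMap (p := p) hφ
  have hmem : ∀ i, ψ i ∈ starHom k (RxComp k) (EComp k) := fun i => by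
    rcases hdeg i with h | ⟨g, hg, -⟩
    · rw [h]
      exact zero_mem _
    · exact Submodule.subset_span ⟨g, hg⟩
  have h : (linearizationEquiv _ hD).symm φ =
      ∑ i, tmul p k (residueMonomial p k i) ⟨ψ i, hmem i⟩ := by
    rw [LinearEquiv.symm_apply_eq, map_sum]
    refine Subtype.ext (hψ.trans ?_)
    rw [Submodule.coe_sum]
    rfl
  rw [h]
  refine AddSubgroup.sum_mem _ fun i _ => ?_
  rcases hdeg i with h0 | ⟨g, hg, hd⟩
  · have : (⟨ψ i, hmem i⟩ : starHom k (RxComp k) (EComp k)) = 0 := Subtype.ext h0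
    rw [this, F.tmul_zero]
    exact zero_mem _
  · exact AddSubgroup.subset_closure
      ⟨_, _, _, g, isHomogeneous_residueMonomial i, hg, hd, rfl⟩

end
end
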